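/- arXiv:1701.07806 — 2 statements merged into one kernel-verified Lean document; each statement's English description precedes it below -/
import Mathlib

section
/- For every η > 0 there exists n_0 such that for every n > n_0 with 3 | n, every 3-uniform hypergraph H on n vertices in which each vertex is contained in at least (5/9 + η)·C(n,2) edges contains a perfect matching. -/
open Finset
open scoped Classical

section Hypergraph

variable {V : Type*} [DecidableEq V]

/-- `S` is the disjoint union of edges of `H`. -/
def IsMatchable (H : Finset (Finset V)) (S : Finset V) : Prop :=
  ∃ M ⊆ H, (M : Set (Finset V)).PairwiseDisjoint id ∧ M.biUnion id = S

lemma IsMatchable.empty (H : Finset (Finset V)) : IsMatchable H ∅ :=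
  ⟨∅, by simp, by simp, by simp⟩

lemma IsMatchable.of_mem {H : Finset (Finset V)} {e : Finset V} (he : e ∈ H) :
    IsMatchable H e :=
  ⟨{e}, by simpa using he, by simp, by simp⟩

lemma IsMatchable.union {H : Finset (Finset V)} {S T : Finset V} (hS : IsMatchable H S)
    (hT : IsMatchable H T) (hST : Disjoint S T) : IsMatchable H (S ∪ T) := by
  obtain ⟨M, hM, hMd, rfl⟩ := hS
  obtain ⟨N, hN, hNd, rfl⟩ := hT
  refine ⟨M ∪ N, union_subset hM hN, ?_, by rw [union_biUnion]⟩
  rw [coe_union, Set.pairwiseDisjoint_union]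
  refine ⟨hMd, hNd, fun e he f hf _ => ?_⟩
  exact hST.mono (subset_biUnion_of_mem id he) (subset_biUnion_of_mem id hf)

/-- The six-set `P` can absorb the set `T`. -/
def IsAbsorber (H : Finset (Finset V)) (P T : Finset V) : Prop :=
  P.card = 6 ∧ Disjoint P T ∧ IsMatchable H P ∧ IsMatchable H (P ∪ T)

lemma isMatchable_union_of_absorbers {H : Finset (Finset V)} (k : ℕ) :
    ∀ (A : Finset (Finset V)) (L : Finset V), (A : Set (Finset V)).PairwiseDisjoint id →
      (∀ P ∈ A, IsMatchable H P) → Disjoint (A.biUnion id) L → L.card = 3 * k →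
      (∀ T : Finset V, T.card = 3 → k ≤ (A.filter fun P => IsAbsorber H P T).card) →
      IsMatchable H (A.biUnion id ∪ L) := by
  induction k with
  | zero =>
    intro A L hA hP _ hL _
    obtain rfl : L = ∅ := by simpa using hL
    rw [union_empty]
    clear hL
    induction A using Finset.induction_on with
    | empty => exact IsMatchable.empty H
    | insert P A hPA ih =>
      rw [biUnion_insert]
      rw [coe_insert, Set.pairwiseDisjoint_insert] at hA
      refine (hP P (mem_insert_self _ _)).union
        (ih hA.1 (fun Q hQ => hP Q (mem_insert_of_mem hQ)) (by simp) (by simp)) ?_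
      rw [disjoint_biUnion_right]
      exact fun Q hQ => hA.2 Q hQ (fun h => hPA (h ▸ hQ))
  | succ k ih =>
    intro A L hA hP hAL hL habs
    obtain ⟨T, hTL, hT⟩ := exists_subset_card_eq (s := L) (n := 3) (by omega)
    obtain ⟨P, hPm⟩ := card_pos.1 (lt_of_lt_of_le (Nat.succ_pos k) (habs T hT))
    rw [mem_filter] at hPm
    obtain ⟨hPA, -, hPT, -, hPTm⟩ := hPm
    have hdP : ∀ Q ∈ A.erase P, Disjoint P Q := fun Q hQ =>
      hA (mem_coe.2 hPA) (mem_coe.2 (mem_of_mem_erase hQ)) (ne_of_mem_erase hQ).symm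
    have key := ih (A.erase P) (L \ T) (hA.subset (by simp))
      (fun Q hQ => hP Q (mem_of_mem_erase hQ))
      (hAL.mono (biUnion_subset_biUnion_of_subset_left _ (erase_subset _ _)) sdiff_subset)
      (by rw [card_sdiff_of_subset hTL]; omega)
      (fun T' hT' => by
        rw [filter_erase]
        have := habs T' hT'
        have := pred_card_le_card_erase (s := A.filter fun Q => IsAbsorber H Q T') (a := P)
        omega)
    have hPL : Disjoint P L := hAL.mono_left (subset_biUnion_of_mem id hPA)
    have hd : Disjoint ((A.erase P).biUnion id ∪ L \ T) (P ∪ T) := by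
      rw [disjoint_union_left, disjoint_union_right, disjoint_union_right]
      refine ⟨⟨?_, ?_⟩, hPL.symm.mono_left sdiff_subset, sdiff_disjoint⟩
      · rw [disjoint_biUnion_left]; exact fun Q hQ => (hdP Q hQ).symm
      · exact hAL.mono (biUnion_subset_biUnion_of_subset_left _ (erase_subset _ _)) hTL
    have := key.union hPTm hd
    convert this using 1
    rw [← insert_erase hPA, biUnion_insert, erase_insert (by simp)]
    ext v
    simp only [mem_union, mem_sdiff, id]
    have := @hTL v
    tauto

/-- Greedy selection of disjoint absorbers, keeping track of the exponential potential
`∑ T, 2 ^ (- #absorbers of T)`. -/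
lemma exists_disjoint_absorbers {H : Finset (Finset V)} {Ω : Type*} [Fintype Ω]
    [Nonempty Ω] (f : Ω → Finset V) (𝒯 : Finset (Finset V)) (c : ℝ) (m : ℕ)
    (hc : ∀ U : Finset V, U.card ≤ 6 * m → ∀ T ∈ 𝒯,
      c * Fintype.card Ω ≤ (univ.filter fun ω => Disjoint (f ω) U ∧ IsAbsorber H (f ω) T).card) :
    ∀ j ≤ m, ∃ A : Finset (Finset V), (A : Set (Finset V)).PairwiseDisjoint id ∧ A.card ≤ j ∧
      (∀ P ∈ A, P.card = 6 ∧ IsMatchable H P) ∧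
      ∑ T ∈ 𝒯, (1 / 2 : ℝ) ^ (A.filter fun P => IsAbsorber H P T).card ≤
        𝒯.card * (1 - c / 2) ^ j := by
  intro j
  induction j with
  | zero => exact fun _ => ⟨∅, by simp⟩
  | succ j ih =>
    intro hj
    obtain ⟨A, hAd, hAc, hA, hpot⟩ := ih (by omega)
    set U := A.biUnion id with hU
    have hUc : U.card ≤ 6 * m := by
      calc U.card ≤ A.card * 6 := card_biUnion_le_card_mul _ _ _ fun P hP => (hA P hP).1.le
        _ ≤ 6 * m := by omega
    set w : Finset V → ℝ := fun T => (1 / 2 : ℝ) ^ (A.filter fun P => IsAbsorber H P T).card with hw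
    have hw0 : ∀ T, 0 < w T := fun T => by positivity
    have hsum : ∑ ω : Ω, ∑ T ∈ 𝒯, w T *
        (if Disjoint (f ω) U ∧ IsAbsorber H (f ω) T then (1 / 2 : ℝ) else 1) ≤
        ∑ ω : Ω, (1 - c / 2) * ∑ T ∈ 𝒯, w T := by
      rw [sum_comm, sum_const, card_univ, nsmul_eq_mul, ← mul_assoc, mul_sum]
      refine sum_le_sum fun T hT => ?_
      have h1 : ∀ ω : Ω, w T *
          (if Disjoint (f ω) U ∧ IsAbsorber H (f ω) T then (1 / 2 : ℝ) else 1) =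
          w T - w T / 2 * (if Disjoint (f ω) U ∧ IsAbsorber H (f ω) T then 1 else 0) := by
        intro ω; split_ifs <;> ring
      simp_rw [h1]
      rw [sum_sub_distrib, ← mul_sum, sum_boole, sum_const, card_univ, nsmul_eq_mul]
      have := hc U hUc T hT
      have h2 := hw0 T
      nlinarith
    obtain ⟨ω, -, hω⟩ := exists_le_of_sum_le univ_nonempty hsum
    have hstep : ∑ T ∈ 𝒯, w T *
        (if Disjoint (f ω) U ∧ IsAbsorber H (f ω) T then (1 / 2 : ℝ) else 1) ≤
        𝒯.card * (1 - c / 2) ^ (j + 1) := by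
      by_cases hneg : 0 ≤ 1 - c / 2
      · refine hω.trans ((mul_le_mul_of_nonneg_left hpot hneg).trans (le_of_eq (by ring)))
      · rcases 𝒯.eq_empty_or_nonempty with rfl | hne
        · simp
        · exfalso
          have h3 : 0 < ∑ T ∈ 𝒯, w T := sum_pos (fun T _ => hw0 T) hne
          have h4 : 0 ≤ ∑ T ∈ 𝒯, w T *
            (if Disjoint (f ω) U ∧ IsAbsorber H (f ω) T then (1 / 2 : ℝ) else 1) :=
            sum_nonneg fun T _ => mul_nonneg (hw0 T).le (by split_ifs <;> norm_num)
          nlinarith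
    by_cases hgood : ∃ T ∈ 𝒯, Disjoint (f ω) U ∧ IsAbsorber H (f ω) T
    · obtain ⟨T₀, -, hdU, hab⟩ := hgood
      have hdisj : ∀ Q ∈ A, Disjoint (f ω) Q := fun Q hQ =>
        hdU.mono_right (subset_biUnion_of_mem id hQ)
      have hnot : f ω ∉ A := fun h => by
        have := hdisj _ h
        rw [disjoint_self, bot_eq_empty] at this
        have h6 := hab.1
        rw [this] at h6
        simp at h6
      refine ⟨insert (f ω) A, ?_, ?_, ?_, ?_⟩
      · rw [coe_insert, Set.pairwiseDisjoint_insert]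
        exact ⟨hAd, fun Q hQ _ => hdisj Q hQ⟩
      · rw [card_insert_of_notMem hnot]; omega
      · intro P hP
        rcases mem_insert.1 hP with rfl | hP
        · exact ⟨hab.1, hab.2.2.1⟩
        · exact hA P hP
      · refine le_trans (le_of_eq (sum_congr rfl fun T _ => ?_)) hstep
        rw [filter_insert]
        by_cases h : IsAbsorber H (f ω) T
        · rw [if_pos h, if_pos ⟨hdU, h⟩, card_insert_of_notMem (by simp [hnot]), pow_succ]
        · rw [if_neg h, if_neg (fun h' => h h'.2), mul_one]
    · push Not at hgood
      refine ⟨A, hAd, by omega, hA, le_trans (le_of_eq (sum_congr rfl fun T hT => ?_)) hstep⟩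
      rw [if_neg (fun h => hgood T hT h.1 h.2), mul_one]

/-- Ordered pairs completing `x` to an edge. -/
def linkPairs [Fintype V] (H : Finset (Finset V)) (x : V) : Finset (V × V) :=
  univ.filter fun p => ({x, p.1, p.2} : Finset V) ∈ H

lemma two_mul_degree_le_card_linkPairs [Fintype V] {H : Finset (Finset V)}
    (hH : ∀ e ∈ H, e.card = 3) (x : V) :
    2 * (H.filter fun e => x ∈ e).card ≤ (linkPairs H x).card := by
  have hmaps : ∀ p ∈ (linkPairs H x),
      ({x, p.1, p.2} : Finset V) ∈ H.filter fun e => x ∈ e := by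
    intro p hp
    simpa [linkPairs] using hp
  rw [card_eq_sum_card_fiberwise (f := fun p : V × V => ({x, p.1, p.2} : Finset V)) hmaps,
    mul_comm, ← smul_eq_mul]
  refine card_nsmul_le_sum _ _ _ fun e he => ?_
  rw [mem_filter] at he
  have hc : (e.erase x).card = 2 := by rw [card_erase_of_mem he.2, hH e he.1]
  obtain ⟨a, b, hab, heq⟩ := card_eq_two.1 hc
  have he' : e = {x, a, b} := by rw [← insert_erase he.2, heq]
  have he'' : e = {x, b, a} := by rw [he', pair_comm]
  have hne : ((a, b) : V × V) ≠ (b, a) := fun h => hab (Prod.ext_iff.1 h).1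
  rw [← card_pair hne]
  refine card_le_card fun p hp => ?_
  rw [mem_insert, mem_singleton] at hp
  rcases hp with rfl | rfl
  · simp only [linkPairs, mem_filter, mem_univ, true_and]
    exact ⟨he' ▸ he.1, he'.symm⟩
  · simp only [linkPairs, mem_filter, mem_univ, true_and]
    exact ⟨he'' ▸ he.1, he''.symm⟩

lemma mul_le_card_filter_prod {α β : Type*} [Fintype α] [Fintype β] {Q : α → Prop}
    {R : α → β → Prop} [DecidablePred Q] [∀ x, DecidablePred (R x)] {a b : ℝ} (hb : 0 ≤ b)
    (hQ : a ≤ (univ.filter Q).card) (hR : ∀ x, Q x → b ≤ (univ.filter (R x)).card) :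
    a * b ≤ (univ.filter fun z : α × β => Q z.1 ∧ R z.1 z.2).card := by
  rw [card_filter, Fintype.sum_prod_type]
  have : ∀ x : α, (if Q x then b else 0) ≤
      ((∑ y : β, if Q x ∧ R x y then 1 else 0 : ℕ) : ℝ) := by
    intro x
    by_cases h : Q x
    · simp only [h, if_true, true_and]
      rw [← card_filter]
      exact hR x h
    · simp [h]
  calc a * b ≤ (univ.filter Q).card * b := mul_le_mul_of_nonneg_right hQ hb
    _ = ∑ x : α, (if Q x then b else 0) := by rw [← sum_filter, sum_const, nsmul_eq_mul]
    _ ≤ ∑ x : α, ((∑ y : β, if Q x ∧ R x y then 1 else 0 : ℕ) : ℝ) := sum_le_sum fun x _ => this x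
    _ = _ := by push_cast; rfl

lemma ne_of_card_triple {x y z : V} (h : ({x, y, z} : Finset V).card = 3) :
    x ≠ y ∧ x ≠ z ∧ y ≠ z := by
  have key : ∀ a b : V, ({a, b} : Finset V).card ≤ 2 := fun a b => card_le_two
  refine ⟨?_, ?_, ?_⟩ <;> rintro rfl
  · rw [insert_idem] at h
    have := key x z
    omega
  · rw [insert_eq_of_mem (by simp)] at h
    have := key y x
    omega
  · rw [pair_eq_singleton] at h
    have := key x y
    omega

lemma card_common_linkPairs_avoiding [Fintype V] {H : Finset (Finset V)} {η : ℝ} (hη : 0 < η)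
    (hn : 400 ≤ Fintype.card V)
    (hdeg : ∀ x, (5 / 9 + η) * (Fintype.card V * (Fintype.card V - 1)) ≤
      ((linkPairs H x).card : ℝ))
    (u v : V) (W : Finset V) (hW : (W.card : ℝ) ≤ η / 8 * Fintype.card V + 9) :
    (Fintype.card V : ℝ) ^ 2 / 20 ≤ (univ.filter fun p : V × V => p.1 ∉ W ∧ p.2 ∉ W ∧
      ({u, p.1, p.2} : Finset V) ∈ H ∧ ({v, p.1, p.2} : Finset V) ∈ H).card := by
  set G := univ.filter fun p : V × V => p.1 ∉ W ∧ p.2 ∉ W ∧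
      ({u, p.1, p.2} : Finset V) ∈ H ∧ ({v, p.1, p.2} : Finset V) ∈ H with hG
  have hsub : linkPairs H u ∩ linkPairs H v ⊆ G ∪ (W ×ˢ univ ∪ univ ×ˢ W) := by
    intro p hp
    simp only [linkPairs, mem_inter, mem_filter, mem_univ, true_and] at hp
    simp only [hG, mem_union, mem_filter, mem_univ, true_and, mem_product, and_true]
    tauto
  have h1 := (card_le_card hsub).trans ((card_union_le _ _).trans
    (add_le_add_right (card_union_le _ _) _))
  rw [card_product, card_product, card_univ] at h1
  have h2 := card_union_add_card_inter (linkPairs H u) (linkPairs H v)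
  have h3 : (linkPairs H u ∪ linkPairs H v).card ≤ Fintype.card V * Fintype.card V := by
    rw [← Fintype.card_prod]; exact card_le_univ _
  have hu := hdeg u
  have hv := hdeg v
  have h4 : (linkPairs H u).card + (linkPairs H v).card ≤
    Fintype.card V * Fintype.card V +
      (G.card + (W.card * Fintype.card V + Fintype.card V * W.card)) := by omega
  have h5 : ((linkPairs H u).card + (linkPairs H v).card : ℝ) ≤
    Fintype.card V * Fintype.card V +
      (G.card + (W.card * Fintype.card V + Fintype.card V * W.card)) := by exact_mod_cast h4
  have hn' : (400 : ℝ) ≤ Fintype.card V := by exact_mod_cast hn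
  generalize (Fintype.card V : ℝ) = n at *
  have h6 : (W.card : ℝ) * n ≤ (η / 8 * n + 9) * n := mul_le_mul_of_nonneg_right hW (by linarith)
  have h7 : 400 * n ≤ n * n := mul_le_mul_of_nonneg_right hn' (by linarith)
  have h8 : 0 ≤ η * (n * (n - 2)) := by
    have : 0 ≤ n - 2 := by linarith
    positivity
  nlinarith

/-- The vertices of a triple of pairs. -/
def vertexSet (ω : ((V × V) × (V × V)) × (V × V)) : Finset V :=
  {ω.1.1.1, ω.1.1.2, ω.1.2.1, ω.1.2.2, ω.2.1, ω.2.2}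

lemma isAbsorber_of_edges {H : Finset (Finset V)} (hH : ∀ e ∈ H, e.card = 3)
    {a b c p₁ p₂ q₁ q₂ r₁ r₂ : V} (hT : ({a, b, c} : Finset V).card = 3)
    (hp₁ : p₁ ∉ ({a, b, c} : Finset V)) (hp₂ : p₂ ∉ ({a, b, c} : Finset V))
    (hq₁ : q₁ ∉ ({a, b, c, p₁, p₂} : Finset V)) (hq₂ : q₂ ∉ ({a, b, c, p₁, p₂} : Finset V))
    (hr₁ : r₁ ∉ ({a, b, c, p₁, p₂, q₁, q₂} : Finset V))
    (hr₂ : r₂ ∉ ({a, b, c, p₁, p₂, q₁, q₂} : Finset V))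
    (hap : {a, p₁, p₂} ∈ H) (hpq : {p₁, q₁, q₂} ∈ H) (hbq : {b, q₁, q₂} ∈ H)
    (hpr : {p₂, r₁, r₂} ∈ H) (hcr : {c, r₁, r₂} ∈ H) :
    IsAbsorber H (vertexSet (((p₁, p₂), (q₁, q₂)), (r₁, r₂))) {a, b, c} := by
  have hP : vertexSet (((p₁, p₂), (q₁, q₂)), (r₁, r₂)) = {p₁, q₁, q₂} ∪ {p₂, r₁, r₂} := by
    ext v; simp only [vertexSet, mem_union, mem_insert, mem_singleton]; rw [iff_iff_eq]; ac_rfl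
  have hPT : vertexSet (((p₁, p₂), (q₁, q₂)), (r₁, r₂)) ∪ {a, b, c} =
      ({a, p₁, p₂} ∪ {b, q₁, q₂}) ∪ {c, r₁, r₂} := by
    ext v; simp only [vertexSet, mem_union, mem_insert, mem_singleton]; rw [iff_iff_eq]; ac_rfl
  obtain ⟨hab, hac, hbc⟩ := ne_of_card_triple hT
  obtain ⟨-, -, hpp⟩ := ne_of_card_triple (hH _ hap)
  obtain ⟨-, -, hqq⟩ := ne_of_card_triple (hH _ hpq)
  obtain ⟨-, -, hrr⟩ := ne_of_card_triple (hH _ hpr)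
  simp only [mem_insert, mem_singleton, not_or, ← ne_eq] at hp₁ hp₂ hq₁ hq₂ hr₁ hr₂
  casesm* _ ∧ _
  have hd : Disjoint ({p₁, q₁, q₂} : Finset V) {p₂, r₁, r₂} := by
    simp only [disjoint_insert_right, disjoint_singleton_right, mem_insert, mem_singleton,
      not_or, ← ne_eq]
    constructorm* _ ∧ _ <;> first | assumption | exact Ne.symm ‹_›
  refine ⟨?_, ?_, ?_, ?_⟩
  · rw [hP, card_union_of_disjoint hd, hH _ hpq, hH _ hpr]
  · rw [hP]
    simp only [disjoint_insert_right, disjoint_singleton_right, mem_union, mem_insert,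
      mem_singleton, not_or, ← ne_eq]
    constructorm* _ ∧ _ <;> first | assumption | exact Ne.symm ‹_›
  · rw [hP]
    exact (IsMatchable.of_mem hpq).union (IsMatchable.of_mem hpr) hd
  · rw [hPT]
    refine ((IsMatchable.of_mem hap).union (IsMatchable.of_mem hbq) ?_).union
      (IsMatchable.of_mem hcr) ?_
    · simp only [disjoint_insert_right, disjoint_singleton_right, mem_insert, mem_singleton,
      not_or, ← ne_eq]
      constructorm* _ ∧ _ <;> first | assumption | exact Ne.symm ‹_›
    · simp only [disjoint_insert_right, disjoint_singleton_right, mem_union, mem_insert,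
        mem_singleton, not_or, ← ne_eq]
      constructorm* _ ∧ _ <;> first | assumption | exact Ne.symm ‹_›

lemma card_absorbers_avoiding [Fintype V] {H : Finset (Finset V)} (hH : ∀ e ∈ H, e.card = 3)
    {η : ℝ} (hη : 0 < η) (hn : 400 ≤ Fintype.card V)
    (hdeg : ∀ x, (5 / 9 + η) * (Fintype.card V * (Fintype.card V - 1)) ≤
      ((linkPairs H x).card : ℝ))
    (U T : Finset V) (hU : (U.card : ℝ) ≤ η / 8 * Fintype.card V) (hT : T.card = 3) :
    1 / 8000 * (Fintype.card (((V × V) × (V × V)) × (V × V)) : ℝ) ≤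
      (univ.filter fun ω : ((V × V) × (V × V)) × (V × V) =>
        Disjoint (vertexSet ω) U ∧ IsAbsorber H (vertexSet ω) T).card := by
  obtain ⟨a, b, c, -, -, -, rfl⟩ := card_eq_three.1 hT
  have hcard : ∀ S : Finset V, S.card ≤ 7 → ((U ∪ S).card : ℝ) ≤ η / 8 * Fintype.card V + 9 := by
    intro S hS
    have h1 : ((U ∪ S).card : ℝ) ≤ U.card + S.card := by exact_mod_cast card_union_le _ _
    have h2 : (S.card : ℝ) ≤ 7 := by exact_mod_cast hS
    linarith
  have link := card_common_linkPairs_avoiding hη hn hdeg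
  have hpos : (0 : ℝ) ≤ (Fintype.card V : ℝ) ^ 2 / 20 := by positivity
  have hp := link a a (U ∪ {a, b, c}) (hcard _ (card_le_three.trans (by norm_num)))
  have hpq := mul_le_card_filter_prod (R := fun (p q : V × V) =>
    q.1 ∉ U ∪ {a, b, c, p.1, p.2} ∧ q.2 ∉ U ∪ {a, b, c, p.1, p.2} ∧
      ({p.1, q.1, q.2} : Finset V) ∈ H ∧ ({b, q.1, q.2} : Finset V) ∈ H) hpos hp
    fun p _ => link p.1 b _ (hcard _ (card_le_five.trans (by norm_num)))
  have hpqr := mul_le_card_filter_prod (R := fun (z : (V × V) × (V × V)) (r : V × V) =>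
    r.1 ∉ U ∪ {a, b, c, z.1.1, z.1.2, z.2.1, z.2.2} ∧
      r.2 ∉ U ∪ {a, b, c, z.1.1, z.1.2, z.2.1, z.2.2} ∧
      ({z.1.2, r.1, r.2} : Finset V) ∈ H ∧ ({c, r.1, r.2} : Finset V) ∈ H) hpos hpq
    fun z _ => link z.1.2 c _ (hcard _ ((card_insert_le _ _).trans (Nat.succ_le_succ card_le_six)))
  refine le_trans (le_of_eq ?_) (hpqr.trans ?_)
  · simp only [Fintype.card_prod]; push_cast; ring
  · refine Nat.cast_le.2 (card_le_card fun ω hω => ?_)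
    obtain ⟨⟨⟨p₁, p₂⟩, ⟨q₁, q₂⟩⟩, ⟨r₁, r₂⟩⟩ := ω
    simp only [mem_filter, mem_univ, true_and, mem_union, not_or] at hω ⊢
    obtain ⟨⟨⟨⟨hp₁, hp₁'⟩, ⟨hp₂, hp₂'⟩, h1, -⟩, ⟨hq₁, hq₁'⟩, ⟨hq₂, hq₂'⟩, h2, h3⟩,
      ⟨hr₁, hr₁'⟩, ⟨hr₂, hr₂'⟩, h4, h5⟩ := hω
    refine ⟨?_, isAbsorber_of_edges hH hT hp₁' hp₂' hq₁' hq₂' hr₁' hr₂' h1 h2 h3 h4 h5⟩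
    simp only [vertexSet, disjoint_insert_left, disjoint_singleton_left]
    exact ⟨hp₁, hp₂, hq₁, hq₂, hr₁, hr₂⟩

/-- A small family of pairwise disjoint six-sets which can absorb any bounded number of
triples. -/
lemma exists_absorbing_family {η : ℝ} (hη : 0 < η) (K : ℕ) :
    ∃ n₀ : ℕ, ∀ (V : Type) [Fintype V] [DecidableEq V], n₀ ≤ Fintype.card V →
      ∀ H : Finset (Finset V), (∀ e ∈ H, e.card = 3) →
      (∀ x, (5 / 9 + η) * (Fintype.card V * (Fintype.card V - 1)) ≤
        ((linkPairs H x).card : ℝ)) →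
      ∃ A : Finset (Finset V), (A : Set (Finset V)).PairwiseDisjoint id ∧
        (∀ P ∈ A, P.card = 6 ∧ IsMatchable H P) ∧
        ((A.biUnion id).card : ℝ) ≤ η / 8 * Fintype.card V ∧
        ∀ T : Finset V, T.card = 3 → K ≤ (A.filter fun P => IsAbsorber H P T).card := by
  obtain ⟨q, hq⟩ := exists_nat_gt (48 / η)
  have hq0 : (0 : ℝ) < q := lt_trans (by positivity) hq
  have hq0' : 0 < q := by exact_mod_cast hq0
  have hlim := tendsto_pow_const_mul_const_pow_of_lt_one 3
    (r := 1 - 1 / 8000 / 2) (by norm_num) (by norm_num)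
  have hev := hlim.eventually (gt_mem_nhds (show (0 : ℝ) < (1 / 2) ^ K / (2 * q) ^ 3 by positivity))
  obtain ⟨m₀, hm₀⟩ := Filter.eventually_atTop.1 hev
  refine ⟨400 + q * (m₀ + 1), fun V _ _ hn H hH hdeg => ?_⟩
  set n := Fintype.card V with hnd
  set m := n / q with hm
  have hmm₀ : m₀ + 1 ≤ m := (Nat.le_div_iff_mul_le hq0').2 (by rw [mul_comm]; omega)
  have hmn : m * q ≤ n := Nat.div_mul_le_self n q
  have hnm : n ≤ 2 * q * m := by
    have := Nat.lt_mul_div_succ n hq0'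
    have h2 : q * 1 ≤ q * m := Nat.mul_le_mul_left q (by omega)
    rw [← hm] at this
    nlinarith
  have h6m : (6 * m : ℝ) ≤ η / 8 * n := by
    have h1 : (m * q : ℝ) ≤ n := by exact_mod_cast hmn
    have h2 : 48 < q * η := by rwa [div_lt_iff₀ hη] at hq
    have h3 : (48 : ℝ) * m ≤ q * η * m := mul_le_mul_of_nonneg_right h2.le (by positivity)
    nlinarith
  have : Nonempty V := Fintype.card_pos_iff.1 (by omega)
  obtain ⟨A, hAd, hAc, hA, hpot⟩ := exists_disjoint_absorbers (H := H)
    (Ω := ((V × V) × (V × V)) × (V × V)) vertexSet (powersetCard 3 univ) (1 / 8000) m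
    (fun U hU T hT => card_absorbers_avoiding hH hη (by omega) hdeg U T
      (le_trans (by exact_mod_cast hU) h6m) (mem_powersetCard.1 hT).2) m le_rfl
  refine ⟨A, hAd, hA, ?_, fun T hT => ?_⟩
  · refine le_trans ?_ h6m
    have : (A.biUnion id).card ≤ A.card * 6 :=
      card_biUnion_le_card_mul _ _ _ fun P hP => (hA P hP).1.le
    exact_mod_cast (show (A.biUnion id).card ≤ 6 * m by omega)
  · by_contra hlt
    push Not at hlt
    have hTm : T ∈ powersetCard 3 (univ : Finset V) := mem_powersetCard.2 ⟨subset_univ _, hT⟩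
    have h1 := (single_le_sum (fun T _ => by positivity) hTm).trans hpot
    have h2 : (1 / 2 : ℝ) ^ K ≤ (1 / 2) ^ (A.filter fun P => IsAbsorber H P T).card :=
      pow_le_pow_of_le_one (by norm_num) (by norm_num) hlt.le
    have h3 : ((powersetCard 3 (univ : Finset V)).card : ℝ) ≤ (2 * q) ^ 3 * m ^ 3 := by
      rw [card_powersetCard, card_univ, ← hnd, ← mul_pow]
      exact_mod_cast (Nat.choose_le_pow n 3).trans (Nat.pow_le_pow_left hnm 3)
    have h4 := hm₀ m (by omega)
    rw [lt_div_iff₀ (by positivity)] at h4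
    have h5 := h2.trans (h1.trans (mul_le_mul_of_nonneg_right h3 (by norm_num)))
    linarith

/-- A matching of `H` avoiding `U`, of maximum size. -/
structure IsMaxMatchingAvoiding (H : Finset (Finset V)) (U : Finset V) (M : Finset (Finset V)) :
    Prop where
  subset : M ⊆ H
  disjoint : (M : Set (Finset V)).PairwiseDisjoint id
  avoids : ∀ e ∈ M, Disjoint e U
  card_le : ∀ N ⊆ H, (N : Set (Finset V)).PairwiseDisjoint id → (∀ e ∈ N, Disjoint e U) →
    N.card ≤ M.card

lemma IsMaxMatchingAvoiding.disjoint_biUnion {H : Finset (Finset V)} {U : Finset V}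
    {M : Finset (Finset V)} (hM : IsMaxMatchingAvoiding H U M) : Disjoint U (M.biUnion id) := by
  rw [disjoint_biUnion_right]
  exact fun e he => (hM.avoids e he).symm

lemma exists_isMaxMatchingAvoiding (H : Finset (Finset V)) (U : Finset V) :
    ∃ M, IsMaxMatchingAvoiding H U M := by
  obtain ⟨M, hM, hmax⟩ := exists_max_image
    (H.powerset.filter fun N : Finset (Finset V) => (N : Set (Finset V)).PairwiseDisjoint id ∧
      ∀ e ∈ N, Disjoint e U) card ⟨∅, by simp⟩
  simp only [mem_filter, mem_powerset] at hM hmax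
  exact ⟨M, hM.1, hM.2.1, hM.2.2, fun N h1 h2 h3 => hmax N ⟨h1, h2, h3⟩⟩

lemma exists_injective_mem {ι α : Type*} [Fintype ι] (t : ι → Finset α)
    (ht : ∀ i, Fintype.card ι ≤ (t i).card) :
    ∃ f : ι → α, Function.Injective f ∧ ∀ i, f i ∈ t i := by
  refine (all_card_le_biUnion_card_iff_exists_injective t).1 fun s => ?_
  rcases s.eq_empty_or_nonempty with rfl | ⟨i, hi⟩
  · simp
  · exact (card_le_univ s).trans ((ht i).trans (card_le_card (subset_biUnion_of_mem t hi)))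

/-- Vertices outside `U` missed by `M`. -/
def uncovered [Fintype V] (U : Finset V) (M : Finset (Finset V)) : Finset V :=
  univ \ (U ∪ M.biUnion id)

/-- Vertices of `X` completing the pair `u, v` to an edge. -/
def pairLink (H : Finset (Finset V)) (X : Finset V) (u v : V) : Finset V :=
  X.filter fun x => ({x, u, v} : Finset V) ∈ H

lemma pairLink_comm (H : Finset (Finset V)) (X : Finset V) (u v : V) :
    pairLink H X u v = pairLink H X v u := by
  unfold pairLink
  simp_rw [pair_comm u v]

namespace IsMaxMatchingAvoiding

variable [Fintype V] {H : Finset (Finset V)} {U : Finset V} {M : Finset (Finset V)}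

lemma card_le_of_replacement (hM : IsMaxMatchingAvoiding H U M) (hH : ∀ e ∈ H, e.card = 3)
    {M₀ : Finset (Finset V)} (hM₀ : M₀ ⊆ M) {ι : Type*} [Fintype ι] (e : ι → Finset V)
    (heH : ∀ i, e i ∈ H) (hed : ∀ i j, i ≠ j → Disjoint (e i) (e j))
    (heX : ∀ i, e i ⊆ uncovered U M ∪ M₀.biUnion id) : Fintype.card ι ≤ M₀.card := by
  have hinj : Function.Injective e := by
    intro i j hij
    by_contra hne
    have h := hed i j hne
    rw [hij, disjoint_self, bot_eq_empty] at h
    have h3 := hH _ (heH j)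
    rw [h] at h3
    simp at h3
  have hcross : ∀ E ∈ M \ M₀, ∀ i, Disjoint E (e i) := by
    intro E hE i
    rw [mem_sdiff] at hE
    refine Disjoint.mono_right (heX i) ?_
    rw [disjoint_union_right, disjoint_biUnion_right]
    refine ⟨?_, fun F hF => hM.disjoint hE.1 (hM₀ hF) fun h => hE.2 (h ▸ hF)⟩
    exact disjoint_sdiff.mono_left ((subset_biUnion_of_mem id hE.1).trans subset_union_right)
  have hdis : Disjoint (M \ M₀) (univ.image e) := by
    rw [Finset.disjoint_left]
    intro E hE hE'
    obtain ⟨i, -, rfl⟩ := mem_image.1 hE'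
    have h := hcross _ hE i
    rw [disjoint_self, bot_eq_empty] at h
    have h3 := hH _ (heH i)
    rw [h] at h3
    simp at h3
  have hle := hM.card_le (M \ M₀ ∪ univ.image e) ?_ ?_ ?_
  · rw [card_union_of_disjoint hdis, card_sdiff_of_subset hM₀, card_image_of_injective _ hinj,
      card_univ] at hle
    have := card_le_card hM₀
    omega
  · refine union_subset (sdiff_subset.trans hM.subset) fun E hE => ?_
    obtain ⟨i, -, rfl⟩ := mem_image.1 hE
    exact heH i
  · rw [coe_union, Set.pairwiseDisjoint_union]
    refine ⟨hM.disjoint.subset (by simp), ?_, ?_⟩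
    · intro E hE F hF hne
      obtain ⟨i, -, rfl⟩ := mem_image.1 (mem_coe.1 hE)
      obtain ⟨j, -, rfl⟩ := mem_image.1 (mem_coe.1 hF)
      exact hed i j fun h => hne (h ▸ rfl)
    · intro E hE F hF _
      obtain ⟨j, -, rfl⟩ := mem_image.1 (mem_coe.1 hF)
      exact hcross E hE j
  · intro E hE
    rcases mem_union.1 hE with hE | hE
    · exact hM.avoids E (mem_sdiff.1 hE).1
    · obtain ⟨i, -, rfl⟩ := mem_image.1 hE
      refine Disjoint.mono_left (heX i) ?_
      rw [disjoint_union_left, disjoint_biUnion_left]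
      exact ⟨sdiff_disjoint.mono_right subset_union_left, fun F hF => hM.avoids F (hM₀ hF)⟩

lemma not_mem_uncovered {E : Finset V} (hE : E ∈ M) {v : V} (hv : v ∈ E) :
    v ∉ uncovered U M := by
  simp only [uncovered, mem_sdiff, mem_univ, true_and, not_not, mem_union, mem_biUnion, id]
  exact Or.inr ⟨E, hE, hv⟩

lemma card_le_of_pairs (hM : IsMaxMatchingAvoiding H U M) (hH : ∀ e ∈ H, e.card = 3)
    {M₀ : Finset (Finset V)} (hM₀ : M₀ ⊆ M) {ι : Type*} [Fintype ι] (u v : ι → V)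
    (hui : Function.Injective u) (hvi : Function.Injective v) (hne : ∀ i j, u i ≠ v j)
    (hu : ∀ i, u i ∈ M₀.biUnion id)
    (hv : ∀ i, v i ∈ M₀.biUnion id)
    (hlink : ∀ i, Fintype.card ι ≤ (pairLink H (uncovered U M) (u i) (v i)).card) :
    Fintype.card ι ≤ M₀.card := by
  obtain ⟨x, hxinj, hx⟩ := exists_injective_mem _ hlink
  simp only [pairLink, mem_filter] at hx
  have hout : ∀ w ∈ M₀.biUnion id, ∀ i, x i ≠ w := by
    rintro w hw i rfl
    obtain ⟨E, hE, hwE⟩ := mem_biUnion.1 hw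
    exact not_mem_uncovered (hM₀ hE) hwE (hx i).1
  refine hM.card_le_of_replacement hH hM₀ (fun i => {x i, u i, v i}) (fun i => (hx i).2) ?_ ?_
  · intro i j hij
    simp only [disjoint_insert_right, disjoint_singleton_right, mem_insert, mem_singleton,
      not_or, ← ne_eq]
    exact ⟨⟨hxinj.ne hij.symm, hout _ (hu i) j, hout _ (hv i) j⟩,
      ⟨(hout _ (hu j) i).symm, hui.ne hij.symm, hne j i⟩,
      (hout _ (hv j) i).symm, (hne i j).symm, hvi.ne hij.symm⟩
  · intro i w hw
    simp only [mem_insert, mem_singleton] at hw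
    rcases hw with rfl | rfl | rfl
    · exact mem_union_left _ (hx i).1
    · exact mem_union_right _ (hu i)
    · exact mem_union_right _ (hv i)

lemma not_subset_uncovered (hM : IsMaxMatchingAvoiding H U M) (hH : ∀ e ∈ H, e.card = 3)
    {e : Finset V} (he : e ∈ H) : ¬ e ⊆ uncovered U M := by
  intro h
  have := hM.card_le_of_replacement hH (empty_subset M) (ι := Unit) (fun _ => e) (fun _ => he)
    (fun i j hij => absurd (Subsingleton.elim i j) hij) (fun _ => by simpa using h)
  simp at this

/-- Two vertices of one matching edge cannot both have many links inside the uncovered set. -/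
lemma not_two_linked (hM : IsMaxMatchingAvoiding H U M) (hH : ∀ e ∈ H, e.card = 3)
    {E : Finset V} (hE : E ∈ M) {a b : V} (ha : a ∈ E) (hb : b ∈ E) (hab : a ≠ b)
    (hla : 4 * (uncovered U M).card < ((uncovered U M ×ˢ uncovered U M).filter
      fun p => ({p.1, p.2, a} : Finset V) ∈ H).card)
    (hlb : 4 * (uncovered U M).card < ((uncovered U M ×ˢ uncovered U M).filter
      fun p => ({p.1, p.2, b} : Finset V) ∈ H).card) : False := by
  have haX := not_mem_uncovered (U := U) hE ha
  have hbX := not_mem_uncovered (U := U) hE hb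
  set X := uncovered U M with hX
  obtain ⟨⟨x, y⟩, hxy⟩ := card_pos.1 (lt_of_le_of_lt (Nat.zero_le _) hla)
  simp only [mem_filter, mem_product] at hxy
  obtain ⟨⟨hx, hy⟩, hxya⟩ := hxy
  have hcov : ¬ (X ×ˢ X).filter (fun p => ({p.1, p.2, b} : Finset V) ∈ H) ⊆
      {x, y} ×ˢ X ∪ X ×ˢ {x, y} := by
    intro h
    have h1 := (card_le_card h).trans (card_union_le _ _)
    rw [card_product, card_product] at h1
    have h2 : ({x, y} : Finset V).card ≤ 2 := card_le_two
    nlinarith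
  obtain ⟨⟨z, w⟩, hzw, hzw'⟩ := not_subset.1 hcov
  simp only [mem_filter, mem_product, mem_union, mem_insert, mem_singleton] at hzw hzw'
  obtain ⟨⟨hz, hw⟩, hzwb⟩ := hzw
  have hzx : z ≠ x := by rintro rfl; tauto
  have hzy : z ≠ y := by rintro rfl; tauto
  have hwx : w ≠ x := by rintro rfl; tauto
  have hwy : w ≠ y := by rintro rfl; tauto
  have hne : ∀ {s t : V}, s ∈ X → t ∉ X → s ≠ t := fun hs ht h => ht (h ▸ hs)
  have hdis : Disjoint ({x, y, a} : Finset V) {z, w, b} := by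
    simp only [disjoint_insert_right, disjoint_singleton_right, mem_insert, mem_singleton,
      not_or, ← ne_eq]
    exact ⟨⟨hzx, hzy, hne hz haX⟩, ⟨hwx, hwy, hne hw haX⟩, (hne hx hbX).symm, (hne hy hbX).symm,
      hab.symm⟩
  have := hM.card_le_of_replacement hH (singleton_subset_iff.2 hE) (ι := Bool)
    (fun i => if i then {x, y, a} else {z, w, b}) ?_ ?_ ?_
  · simp at this
  · rintro (_ | _) <;> simpa
  · rintro (_ | _) (_ | _) h
    · exact absurd rfl h
    · simpa using hdis.symm
    · simpa using hdis
    · exact absurd rfl h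
  · rintro (_ | _) v hv
    · simp only [Bool.false_eq_true, if_false, mem_insert, mem_singleton] at hv
      rw [singleton_biUnion, mem_union]
      rcases hv with rfl | rfl | rfl
      exacts [Or.inl hz, Or.inl hw, Or.inr hb]
    · simp only [if_true, mem_insert, mem_singleton] at hv
      rw [singleton_biUnion, mem_union]
      rcases hv with rfl | rfl | rfl
      exacts [Or.inl hx, Or.inl hy, Or.inr ha]

end IsMaxMatchingAvoiding

lemma card_le_five_of_no_perfect_matching (B : Fin 3 → Fin 3 → Prop)
    (hB : ¬ ∃ σ : Equiv.Perm (Fin 3), ∀ i, B i (σ i)) :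
    (∑ i, ∑ j, if B i j then 1 else 0) ≤
      5 + (if 2 ≤ (univ.filter fun i => ∀ j, B i j).card then 1 else 0) +
        (if 2 ≤ (univ.filter fun j => ∀ i, B i j).card then 1 else 0) := by
  have key : ∀ a b c d e f g h k : Bool,
      (a && e && k || a && f && h || b && d && k || b && f && g || c && d && h || c && e && g) = true ∨
      a.toNat + b.toNat + c.toNat + (d.toNat + e.toNat + f.toNat) + (g.toNat + h.toNat + k.toNat) ≤
      5 + (2 ≤ (a && b && c).toNat + (d && e && f).toNat + (g && h && k).toNat : Bool).toNat +
        (2 ≤ (a && d && g).toNat + (b && e && h).toNat + (c && f && k).toNat : Bool).toNat := by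
    decide
  have htoNat (p : Prop) [Decidable p] : (if p then 1 else 0) = (decide p).toNat := by
    by_cases hp : p <;> simp [hp]
  have hσ (σ : Equiv.Perm (Fin 3)) : ¬ (B 0 (σ 0) ∧ B 1 (σ 1) ∧ B 2 (σ 2)) := fun h =>
    hB ⟨σ, fun i => by fin_cases i <;> simp [h]⟩
  simp only [card_filter, Fin.sum_univ_three, Fin.forall_fin_succ, htoNat]
  have h3 := key (B 0 0) (B 0 1) (B 0 2) (B 1 0) (B 1 1) (B 1 2) (B 2 0) (B 2 1) (B 2 2)
  rcases h3 with h3 | h3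
  · exfalso
    have h1 := hσ 1
    have h2 := hσ (Equiv.swap 1 2)
    have h4 := hσ (Equiv.swap 0 1)
    have h5 := hσ (finRotate 3)
    have h6 := hσ (finRotate 3)⁻¹
    have h7 := hσ (Equiv.swap 0 2)
    change ¬ (B 0 0 ∧ B 1 1 ∧ B 2 2) at h1
    change ¬ (B 0 0 ∧ B 1 2 ∧ B 2 1) at h2
    change ¬ (B 0 1 ∧ B 1 0 ∧ B 2 2) at h4
    change ¬ (B 0 1 ∧ B 1 2 ∧ B 2 0) at h5
    change ¬ (B 0 2 ∧ B 1 0 ∧ B 2 1) at h6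
    change ¬ (B 0 2 ∧ B 1 1 ∧ B 2 0) at h7
    simp only [Bool.or_eq_true, Bool.and_eq_true, decide_eq_true_eq, and_assoc] at h3
    obtain ((((h | h) | h) | h) | h) | h := h3
    exacts [h1 h, h2 h, h4 h, h5 h, h6 h, h7 h]
  · simpa [Bool.decide_and, and_assoc, Bool.and_assoc] using h3

/-- A Kővári–Sós–Turán bound: few pairs are related if no three points are related to two
common points. -/
lemma card_rel_le {J : Type*} [Fintype J] (R : J → J → Prop)
    (hR : ∀ F F', F ≠ F' → (univ.filter fun E => R E F ∧ R E F').card ≤ 2) (t : ℕ) :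
    2 * t * (∑ E, ∑ F, if R E F then 1 else 0) ≤
      2 * Fintype.card J ^ 2 + (∑ E, ∑ F, if R E F then 1 else 0) + Fintype.card J * t ^ 2 := by
  set d : J → ℕ := fun E => ∑ F, if R E F then 1 else 0 with hd
  have hsq : ∑ E, d E ^ 2 ≤ 2 * Fintype.card J ^ 2 + ∑ E, d E := by
    have h1 : ∀ E, d E ^ 2 = ∑ F, ∑ F', if R E F ∧ R E F' then 1 else 0 := by
      intro E
      rw [sq, hd, sum_mul_sum]
      refine sum_congr rfl fun F _ => sum_congr rfl fun F' _ => ?_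
      by_cases h1 : R E F <;> by_cases h2 : R E F' <;> simp [h1, h2]
    have h2 : ∀ F F', (∑ E, if R E F ∧ R E F' then 1 else 0) ≤
        2 + if F = F' then (∑ E, if R E F then 1 else 0) else 0 := by
      intro F F'
      by_cases h : F = F'
      · subst h; simp
      · simpa [h] using hR F F' h
    calc ∑ E, d E ^ 2 = ∑ F, ∑ F', ∑ E, if R E F ∧ R E F' then 1 else 0 := by
          simp_rw [h1]
          rw [sum_comm]
          exact sum_congr rfl fun F _ => sum_comm
      _ ≤ ∑ F : J, ∑ F' : J, (2 + if F = F' then (∑ E, if R E F then 1 else 0) else 0) :=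
          sum_le_sum fun F _ => sum_le_sum fun F' _ => h2 F F'
      _ = 2 * Fintype.card J ^ 2 + ∑ E, d E := by
          simp only [sum_add_distrib, sum_const, card_univ, smul_eq_mul, sum_ite_eq, mem_univ,
            if_true]
          rw [hd, sum_comm (γ := J)]
          ring
  have hamgm : ∀ E, 2 * t * d E ≤ d E ^ 2 + t ^ 2 := fun E => by
    have := two_mul_le_add_sq t (d E)
    linarith
  calc 2 * t * ∑ E, d E = ∑ E, 2 * t * d E := mul_sum _ _ _
    _ ≤ ∑ E, (d E ^ 2 + t ^ 2) := sum_le_sum fun E _ => hamgm E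
    _ = ∑ E, d E ^ 2 + Fintype.card J * t ^ 2 := by
        rw [sum_add_distrib, sum_const, card_univ, smul_eq_mul]
    _ ≤ _ := by linarith

lemma exists_labelling {M : Finset (Finset V)} (hM : (M : Set (Finset V)).PairwiseDisjoint id)
    (h3 : ∀ e ∈ M, e.card = 3) :
    ∃ φ : M × Fin 3 → V, Function.Injective φ ∧ ∀ p, φ p ∈ (p.1 : Finset V) := by
  refine ⟨fun p => ((p.1 : Finset V).equivFinOfCardEq (h3 _ p.1.2)).symm p.2, ?_,
    fun p => Subtype.property _⟩
  rintro ⟨E, i⟩ ⟨F, j⟩ h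
  obtain rfl : E = F := by
    by_contra hne
    have h1 := ((E : Finset V).equivFinOfCardEq (h3 _ E.2)).symm i |>.2
    have h2 := ((F : Finset V).equivFinOfCardEq (h3 _ F.2)).symm j |>.2
    simp only at h
    rw [h] at h1
    exact Finset.disjoint_left.1 (hM E.2 F.2 fun h => hne (Subtype.ext h)) h1 h2
  simpa using h

lemma sum_biUnion_eq_sum_labels {M : Finset (Finset V)}
    (hM : (M : Set (Finset V)).PairwiseDisjoint id) (h3 : ∀ e ∈ M, e.card = 3)
    {φ : M × Fin 3 → V} (hφ : Function.Injective φ) (hφM : ∀ p, φ p ∈ (p.1 : Finset V))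
    (f : V → ℕ) : ∑ v ∈ M.biUnion id, f v = ∑ E : M, ∑ i, f (φ (E, i)) := by
  rw [sum_biUnion hM, ← sum_coe_sort M]
  refine sum_congr rfl fun E _ => ?_
  have hinj : Function.Injective fun i => φ (E, i) := fun i j h => by simpa using hφ h
  have himg : (univ.image fun i => φ (E, i)) = (E : Finset V) := by
    refine eq_of_subset_of_card_le (fun v hv => ?_) ?_
    · obtain ⟨i, -, rfl⟩ := mem_image.1 hv
      exact hφM _
    · rw [card_image_of_injective _ hinj, h3 _ E.2, card_univ, Fintype.card_fin]
  change ∑ v ∈ (E : Finset V), f v = _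
  rw [← himg, sum_image fun i _ j _ h => hinj h]

/-- The labels of vertices of `E` which, together with any vertex of `F`, have at least six
links in `X`. -/
def fullRows (H : Finset (Finset V)) (X : Finset V) {M : Finset (Finset V)}
    (φ : M × Fin 3 → V) (E F : M) : Finset (Fin 3) :=
  univ.filter fun i => ∀ j, 6 ≤ (pairLink H X (φ (E, i)) (φ (F, j))).card

/-- Two vertices of `E` are fully linked to `F`. -/
def Dominates (H : Finset (Finset V)) (X : Finset V) {M : Finset (Finset V)}
    (φ : M × Fin 3 → V) (E F : M) : Prop :=
  E ≠ F ∧ 2 ≤ (fullRows H X φ E F).card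

namespace IsMaxMatchingAvoiding

variable [Fintype V] {H : Finset (Finset V)} {U : Finset V} {M : Finset (Finset V)}

lemma sum_card_pairLink_le (hM : IsMaxMatchingAvoiding H U M) (hH : ∀ e ∈ H, e.card = 3)
    {φ : M × Fin 3 → V} (hφ : Function.Injective φ) (hφM : ∀ p, φ p ∈ (p.1 : Finset V))
    (E F : M) (hEF : E ≠ F) :
    ∑ i, ∑ j, (pairLink H (uncovered U M) (φ (E, i)) (φ (F, j))).card ≤
      (uncovered U M).card * (5 + (if Dominates H (uncovered U M) φ E F then 1 else 0) +
        (if Dominates H (uncovered U M) φ F E then 1 else 0)) + 45 := by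
  set X := uncovered U M with hX
  obtain ⟨B, hB⟩ : ∃ B : Fin 3 → Fin 3 → Prop, ∀ i j, B i j ↔
      6 ≤ (pairLink H X (φ (E, i)) (φ (F, j))).card := ⟨_, fun _ _ => Iff.rfl⟩
  have hno : ¬ ∃ σ : Equiv.Perm (Fin 3), ∀ i, B i (σ i) := by
    rintro ⟨σ, hσ⟩
    have hle := hM.card_le_of_pairs hH (M₀ := {(E : Finset V), (F : Finset V)})
      (by simp [insert_subset_iff]) (fun i => φ (E, i)) (fun i => φ (F, σ i))
      (fun i j h => by simpa using hφ h) (fun i j h => by simpa using hφ h)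
      (fun i j h => hEF (by simpa using (Prod.ext_iff.1 (hφ h)).1))
      (fun i => mem_biUnion.2 ⟨E, by simp, hφM (E, i)⟩)
      (fun i => mem_biUnion.2 ⟨F, by simp, hφM (F, σ i)⟩)
      (fun i => by
        rw [Fintype.card_fin]
        exact le_trans (by norm_num) ((hB _ _).1 (hσ i)))
    have := hle.trans card_le_two
    simp at this
  have hcount := card_le_five_of_no_perfect_matching B hno
  have hrow : (univ.filter fun i => ∀ j, B i j) = fullRows H X φ E F := by
    ext i
    simp only [hB, fullRows, mem_filter, mem_univ, true_and]
  have hcol : (univ.filter fun j => ∀ i, B i j) = fullRows H X φ F E := by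
    ext j
    simp only [hB, fullRows, mem_filter, mem_univ, true_and]
    exact forall_congr' fun i => by rw [pairLink_comm]
  have hD1 : Dominates H X φ E F ↔ 2 ≤ (fullRows H X φ E F).card := and_iff_right hEF
  have hD2 : Dominates H X φ F E ↔ 2 ≤ (fullRows H X φ F E).card := and_iff_right hEF.symm
  rw [hrow, hcol] at hcount
  simp_rw [hD1, hD2]
  have hterm : ∀ i j, (pairLink H X (φ (E, i)) (φ (F, j))).card ≤
      X.card * (if B i j then 1 else 0) + 5 := by
    intro i j
    have h1 : (pairLink H X (φ (E, i)) (φ (F, j))).card ≤ X.card := card_filter_le _ _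
    split_ifs with h
    · omega
    · simp only [hB, not_le] at h
      omega
  calc _ ≤ ∑ i : Fin 3, ∑ j : Fin 3, (X.card * (if B i j then 1 else 0) + 5) :=
        sum_le_sum fun i _ => sum_le_sum fun j _ => hterm i j
    _ = X.card * (∑ i, ∑ j, if B i j then 1 else 0) + 45 := by
        simp only [sum_add_distrib, mul_sum, sum_const, card_univ, Fintype.card_fin, smul_eq_mul]
    _ ≤ _ := Nat.add_le_add_right (Nat.mul_le_mul_left _ hcount) _

lemma card_common_dominators_le (hM : IsMaxMatchingAvoiding H U M) (hH : ∀ e ∈ H, e.card = 3)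
    {φ : M × Fin 3 → V} (hφ : Function.Injective φ) (hφM : ∀ p, φ p ∈ (p.1 : Finset V))
    (F F' : M) (hF : F ≠ F') :
    (univ.filter fun E => Dominates H (uncovered U M) φ E F ∧
      Dominates H (uncovered U M) φ E F').card ≤ 2 := by
  by_contra! hlt
  set X := uncovered U M with hX
  obtain ⟨Es, hEs, hmem⟩ := exists_injective_mem (ι := Fin 3) (fun _ => univ.filter fun E =>
    Dominates H X φ E F ∧ Dominates H X φ E F') (fun _ => by rw [Fintype.card_fin]; omega)
  simp only [mem_filter, mem_univ, true_and] at hmem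
  set Fs : Fin 2 → M := ![F, F'] with hFs
  have hFsinj : Function.Injective Fs := by
    intro s t h
    fin_cases s <;> fin_cases t <;> simp_all [hF.symm]
  have hdom : ∀ k s, Dominates H X φ (Es k) (Fs s) := by
    intro k s
    fin_cases s
    exacts [(hmem k).1, (hmem k).2]
  choose r hrinj hr using fun k => exists_injective_mem (ι := Fin 2)
    (fun s => fullRows H X φ (Es k) (Fs s)) (fun s => by simpa using (hdom k s).2)
  simp only [fullRows, mem_filter, mem_univ, true_and] at hr
  have hle := hM.card_le_of_pairs hH
    (M₀ := (univ.image fun k => (Es k : Finset V)) ∪ univ.image fun s => (Fs s : Finset V)) ?_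
    (ι := Fin 3 × Fin 2) (fun p => φ (Es p.1, r p.1 p.2)) (fun p => φ (Fs p.2, p.1)) ?_ ?_ ?_
    ?_ ?_ ?_
  · have h1 := hle.trans ((card_union_le _ _).trans (add_le_add card_image_le card_image_le))
    simp at h1
  · intro E hE
    simp only [mem_union, mem_image, mem_univ, true_and] at hE
    rcases hE with ⟨k, rfl⟩ | ⟨s, rfl⟩
    exacts [(Es k).2, (Fs s).2]
  · rintro ⟨k, s⟩ ⟨l, t⟩ h
    have h' := Prod.ext_iff.1 (hφ h)
    obtain rfl : k = l := hEs h'.1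
    obtain rfl : s = t := hrinj k h'.2
    rfl
  · rintro ⟨k, s⟩ ⟨l, t⟩ h
    have h' := Prod.ext_iff.1 (hφ h)
    exact Prod.ext h'.2 (hFsinj h'.1)
  · rintro ⟨k, s⟩ ⟨l, t⟩ h
    exact (hdom k t).1 (Prod.ext_iff.1 (hφ h)).1
  · rintro ⟨k, s⟩
    exact mem_biUnion.2 ⟨Es k, mem_union_left _ (mem_image_of_mem _ (mem_univ k)), hφM (_, _)⟩
  · rintro ⟨k, s⟩
    exact mem_biUnion.2 ⟨Fs s, mem_union_right _ (mem_image_of_mem (fun s => (Fs s : Finset V))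
      (mem_univ s)), hφM (_, _)⟩
  · rintro ⟨k, s⟩
    simpa using hr k s k

lemma sum_inner_pairs_le (hM : IsMaxMatchingAvoiding H U M) (hH : ∀ e ∈ H, e.card = 3)
    {φ : M × Fin 3 → V} (hφ : Function.Injective φ) (hφM : ∀ p, φ p ∈ (p.1 : Finset V)) (E : M) :
    ∑ i, ((uncovered U M ×ˢ uncovered U M).filter
      fun p => ({p.1, p.2, φ (E, i)} : Finset V) ∈ H).card ≤
      (uncovered U M).card ^ 2 + 12 * (uncovered U M).card := by
  have hnot : ∀ i j, i ≠ j → ¬ (_ ∧ _) := fun i j hij h =>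
    hM.not_two_linked hH E.2 (hφM (E, i)) (hφM (E, j)) (hφ.ne (by simpa using hij)) h.1 h.2
  have hle : ∀ i, ((uncovered U M ×ˢ uncovered U M).filter
      fun p => ({p.1, p.2, φ (E, i)} : Finset V) ∈ H).card ≤ (uncovered U M).card ^ 2 := by
    intro i
    rw [sq, ← card_product]
    exact card_filter_le _ _
  have h01 := hnot 0 1 (by decide)
  have h02 := hnot 0 2 (by decide)
  have h12 := hnot 1 2 (by decide)
  have h0 := hle 0
  have h1 := hle 1
  have h2 := hle 2
  rw [Fin.sum_univ_three]
  omega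

/-- Double counting the links of the uncovered vertices. -/
lemma sum_card_linkPairs_le (hM : IsMaxMatchingAvoiding H U M) (hH : ∀ e ∈ H, e.card = 3) :
    ∃ h : ℕ, (∀ t : ℕ, 2 * t * h ≤ 2 * M.card ^ 2 + h + M.card * t ^ 2) ∧
      ∑ x ∈ uncovered U M, (linkPairs H x).card ≤
        (uncovered U M).card * (2 * U.card * Fintype.card V) +
        2 * (M.card * ((uncovered U M).card ^ 2 + 12 * (uncovered U M).card)) +
        ((uncovered U M).card * (5 * M.card ^ 2 + 2 * h + 9 * M.card) + 45 * M.card ^ 2) := by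
  have h3 : ∀ e ∈ M, e.card = 3 := fun e he => hH e (hM.subset he)
  obtain ⟨φ, hφ, hφM⟩ := exists_labelling hM.disjoint h3
  set X := uncovered U M with hX
  set Y := M.biUnion id with hY
  refine ⟨∑ E : M, ∑ F : M, if Dominates H X φ E F then 1 else 0, fun t => ?_, ?_⟩
  · simpa using card_rel_le _ (hM.card_common_dominators_le hH hφ hφM) t
  have hlink : ∀ x ∈ X, (linkPairs H x).card ≤ 2 * U.card * Fintype.card V +
      2 * ((X ×ˢ Y).filter fun p => ({x, p.1, p.2} : Finset V) ∈ H).card +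
      ((Y ×ˢ Y).filter fun p => ({x, p.1, p.2} : Finset V) ∈ H).card := by
    intro x hx
    have hsub : linkPairs H x ⊆ ((U ×ˢ univ ∪ univ ×ˢ U) ∪
        (((X ×ˢ Y).filter fun p => ({x, p.1, p.2} : Finset V) ∈ H) ∪
          ((X ×ˢ Y).filter fun p => ({x, p.1, p.2} : Finset V) ∈ H).image Prod.swap)) ∪
        ((Y ×ˢ Y).filter fun p => ({x, p.1, p.2} : Finset V) ∈ H) := by
      rintro ⟨u, v⟩ huv
      simp only [linkPairs, mem_filter, mem_univ, true_and] at huv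
      have huvX : ¬ (u ∈ X ∧ v ∈ X) := fun h => hM.not_subset_uncovered hH huv (by
        simp only [insert_subset_iff, singleton_subset_iff]
        exact ⟨hx, h.1, h.2⟩)
      have hmem : ∀ w, w ∈ X ∨ w ∈ U ∨ w ∈ Y := by
        intro w
        simp only [hX, uncovered, mem_sdiff, mem_univ, true_and, mem_union]
        tauto
      have hvu : ({x, v, u} : Finset V) ∈ H := by rwa [pair_comm]
      have hswap : (u, v) ∈ ((X ×ˢ Y).filter fun p => ({x, p.1, p.2} : Finset V) ∈ H).image
          Prod.swap ↔ v ∈ X ∧ u ∈ Y := by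
        simp only [mem_image, mem_filter, mem_product, Prod.exists, Prod.swap_prod_mk,
          Prod.mk.injEq]
        constructor
        · rintro ⟨a, b, h, rfl, rfl⟩
          exact h.1
        · exact fun h => ⟨v, u, ⟨h, hvu⟩, rfl, rfl⟩
      simp only [mem_union, hswap, mem_filter, mem_product, mem_univ, true_and, and_true, huv]
      have h1 := hmem u
      have h2 := hmem v
      tauto
    have hc := (card_le_card hsub).trans ((card_union_le _ _).trans (add_le_add_left
      ((card_union_le _ _).trans (add_le_add (card_union_le _ _) ((card_union_le _ _).trans
        (add_le_add_right card_image_le _)))) _))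
    rw [card_product, card_product, card_univ] at hc
    linarith [mul_comm U.card (Fintype.card V)]
  have hXY : ∑ x ∈ X, ((X ×ˢ Y).filter fun p => ({x, p.1, p.2} : Finset V) ∈ H).card ≤
      M.card * (X.card ^ 2 + 12 * X.card) := by
    calc ∑ x ∈ X, ((X ×ˢ Y).filter fun p => ({x, p.1, p.2} : Finset V) ∈ H).card
        = ∑ v ∈ Y, ((X ×ˢ X).filter fun p => ({p.1, p.2, v} : Finset V) ∈ H).card := by
          simp_rw [card_filter, sum_product]
          rw [sum_comm (s := Y)]
          exact sum_congr rfl fun x _ => sum_comm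
      _ = ∑ E : M, ∑ i, ((X ×ˢ X).filter fun p => ({p.1, p.2, φ (E, i)} : Finset V) ∈ H).card :=
          sum_biUnion_eq_sum_labels hM.disjoint h3 hφ hφM _
      _ ≤ ∑ E : M, (X.card ^ 2 + 12 * X.card) :=
          sum_le_sum fun E _ => hM.sum_inner_pairs_le hH hφ hφM E
      _ = _ := by simp
  have hYY : ∑ x ∈ X, ((Y ×ˢ Y).filter fun p => ({x, p.1, p.2} : Finset V) ∈ H).card ≤
      X.card * (5 * M.card ^ 2 + 2 * (∑ E : M, ∑ F : M, if Dominates H X φ E F then 1 else 0) +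
        9 * M.card) + 45 * M.card ^ 2 := by
    have hpair : ∀ E F : M, ∑ i, ∑ j, (pairLink H X (φ (E, i)) (φ (F, j))).card ≤
        X.card * (5 + (if Dominates H X φ E F then 1 else 0) +
          (if Dominates H X φ F E then 1 else 0) + if E = F then 9 else 0) + 45 := by
      intro E F
      by_cases hEF : E = F
      · have h1 : ∀ i j, (pairLink H X (φ (E, i)) (φ (F, j))).card ≤ X.card :=
          fun i j => card_filter_le _ _
        calc _ ≤ ∑ i : Fin 3, ∑ j : Fin 3, X.card :=
              sum_le_sum fun i _ => sum_le_sum fun j _ => h1 i j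
          _ = X.card * 9 := by simp; ring
          _ ≤ _ := by
            rw [if_pos hEF]
            exact (Nat.mul_le_mul_left _ (by omega)).trans (Nat.le_add_right _ _)
      · rw [if_neg hEF]
        exact hM.sum_card_pairLink_le hH hφ hφM E F hEF
    calc ∑ x ∈ X, ((Y ×ˢ Y).filter fun p => ({x, p.1, p.2} : Finset V) ∈ H).card
        = ∑ u ∈ Y, ∑ v ∈ Y, (pairLink H X u v).card := by
          simp_rw [pairLink, card_filter, sum_product]
          rw [sum_comm]
          exact sum_congr rfl fun u _ => sum_comm
      _ = ∑ E : M, ∑ i, ∑ F : M, ∑ j, (pairLink H X (φ (E, i)) (φ (F, j))).card := by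
          rw [sum_biUnion_eq_sum_labels hM.disjoint h3 hφ hφM]
          refine sum_congr rfl fun E _ => sum_congr rfl fun i _ => ?_
          rw [sum_biUnion_eq_sum_labels hM.disjoint h3 hφ hφM]
      _ = ∑ E : M, ∑ F : M, ∑ i, ∑ j, (pairLink H X (φ (E, i)) (φ (F, j))).card :=
          sum_congr rfl fun E _ => sum_comm
      _ ≤ ∑ E : M, ∑ F : M, (X.card * (5 + (if Dominates H X φ E F then 1 else 0) +
          (if Dominates H X φ F E then 1 else 0) + if E = F then 9 else 0) + 45) :=
          sum_le_sum fun E _ => sum_le_sum fun F _ => hpair E F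
      _ = _ := by
          have hsymm : (∑ E : M, ∑ F : M, if Dominates H X φ F E then 1 else 0) =
            ∑ E : M, ∑ F : M, if Dominates H X φ E F then 1 else 0 := sum_comm
          simp only [sum_add_distrib, ← mul_sum, sum_const, card_univ, Fintype.card_coe,
            smul_eq_mul, sum_ite_eq, mem_univ, if_true, hsymm]
          ring
  calc ∑ x ∈ X, (linkPairs H x).card ≤ ∑ x ∈ X, (2 * U.card * Fintype.card V +
      2 * ((X ×ˢ Y).filter fun p => ({x, p.1, p.2} : Finset V) ∈ H).card +
      ((Y ×ˢ Y).filter fun p => ({x, p.1, p.2} : Finset V) ∈ H).card) := sum_le_sum hlink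
    _ ≤ _ := by
      rw [sum_add_distrib, sum_add_distrib, sum_const, ← mul_sum, smul_eq_mul]
      exact add_le_add (add_le_add_right (Nat.mul_le_mul_left _ hXY) _) hYY

end IsMaxMatchingAvoiding

namespace IsMaxMatchingAvoiding

variable [Fintype V] {H : Finset (Finset V)} {U : Finset V} {M : Finset (Finset V)}

lemma card_add_card_add_card_uncovered (hM : IsMaxMatchingAvoiding H U M)
    (hH : ∀ e ∈ H, e.card = 3) :
    U.card + 3 * M.card + (uncovered U M).card = Fintype.card V := by
  have h1 : (M.biUnion id).card = M.card * 3 := by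
    rw [card_biUnion hM.disjoint, sum_const_nat (m := 3)]
    exact fun e he => hH e (hM.subset he)
  rw [uncovered, card_univ_sdiff, card_union_of_disjoint hM.disjoint_biUnion, h1]
  have := card_le_univ (U ∪ M.biUnion id)
  rw [card_union_of_disjoint hM.disjoint_biUnion, h1] at this
  omega

end IsMaxMatchingAvoiding

/-- The numerical contradiction between the degree condition and the double count. -/
lemma uncovered_numeric {η n m x u h t : ℝ} (hη : 0 < η) (hm : 0 ≤ m) (hu : 0 ≤ u) (hn : 0 < n)
    (hsum : u + 3 * m + x = n) (hun : u ≤ η / 8 * n) (hx : 20 / η < x) (ht : 4 / η < t)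
    (ht1 : 1 ≤ t) (hh : 0 ≤ h) (hnt : 3 * (12 + t + η) / η < n)
    (hht : 2 * t * h ≤ 2 * m ^ 2 + h + m * t ^ 2)
    (hcount : x * ((5 / 9 + η) * (n * (n - 1))) ≤ x * (2 * u * n) + 2 * (m * (x ^ 2 + 12 * x)) +
      (x * (5 * m ^ 2 + 2 * h + 9 * m) + 45 * m ^ 2)) : False := by
  have hx0 : 0 < x := lt_trans (by positivity) hx
  have ht0 : 0 < t := by linarith
  rw [div_lt_iff₀ hη] at hx ht hnt
  have hmn : m ≤ n / 3 := by linarith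
  have hm2 : m ^ 2 ≤ n ^ 2 / 9 := by nlinarith
  have h45 : 45 * m ^ 2 ≤ x * (η * n ^ 2 / 4) := by
    have : 20 * n ^ 2 ≤ x * η * n ^ 2 := mul_le_mul_of_nonneg_right hx.le (by positivity)
    nlinarith
  have hdiv : (5 / 9 + η) * (n * (n - 1)) ≤
      2 * u * n + 2 * m * x + 33 * m + 5 * m ^ 2 + 2 * h + η * n ^ 2 / 4 := by
    refine le_of_mul_le_mul_left ?_ hx0
    nlinarith
  have h2u : 2 * u * n ≤ η * n ^ 2 / 4 := by nlinarith
  have hmain : 2 * m * x + 5 * m ^ 2 ≤ 5 / 9 * n ^ 2 := by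
    have h1 : 0 ≤ (n / 3 - m) * (5 * n / 3 - m) :=
      mul_nonneg (by linarith) (by linarith)
    have h2 : m * x ≤ m * (n - 3 * m) := mul_le_mul_of_nonneg_left (by linarith) hm
    nlinarith
  have h2h : 2 * h ≤ η * n ^ 2 / 9 + 2 * t * n / 3 := by
    refine le_of_mul_le_mul_left ?_ ht0
    have h1 : t * h ≤ 2 * m ^ 2 + m * t ^ 2 := by nlinarith
    have h2 : m * t ^ 2 ≤ n / 3 * t ^ 2 := mul_le_mul_of_nonneg_right hmn (by positivity)
    have h3 : 4 * n ^ 2 ≤ t * η * n ^ 2 := mul_le_mul_of_nonneg_right ht.le (by positivity)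
    nlinarith
  have hfin : 7 / 18 * (η * n ^ 2) ≤ (12 + t + η) * n := by nlinarith
  nlinarith

lemma exists_bound_uncovered {η : ℝ} (hη : 0 < η) :
    ∃ K n₀ : ℕ, ∀ (V : Type) [Fintype V] [DecidableEq V], n₀ ≤ Fintype.card V →
      ∀ H : Finset (Finset V), (∀ e ∈ H, e.card = 3) →
      (∀ x, (5 / 9 + η) * (Fintype.card V * (Fintype.card V - 1)) ≤
        ((linkPairs H x).card : ℝ)) →
      ∀ (U : Finset V) (M : Finset (Finset V)), (U.card : ℝ) ≤ η / 8 * Fintype.card V →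
        IsMaxMatchingAvoiding H U M → (uncovered U M).card ≤ K := by
  obtain ⟨K, hK⟩ := exists_nat_gt (20 / η)
  obtain ⟨t, ht⟩ := exists_nat_gt (4 / η)
  obtain ⟨n₀, hn₀⟩ := exists_nat_gt (3 * (12 + (t : ℝ) + η) / η)
  refine ⟨K, n₀, fun V _ _ hn H hH hdeg U M hU hM => ?_⟩
  by_contra! hlt
  obtain ⟨h, hht, hcount⟩ := hM.sum_card_linkPairs_le hH
  have hn₀n : (n₀ : ℝ) ≤ Fintype.card V := by exact_mod_cast hn
  have ht0 : (0 : ℝ) < t := lt_trans (by positivity) ht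
  have hlow : ((uncovered U M).card : ℝ) *
      ((5 / 9 + η) * (Fintype.card V * (Fintype.card V - 1))) ≤
      ((∑ x ∈ uncovered U M, (linkPairs H x).card : ℕ) : ℝ) := by
    rw [← nsmul_eq_mul, Nat.cast_sum]
    exact card_nsmul_le_sum _ _ _ fun x _ => hdeg x
  refine uncovered_numeric (η := η) (n := Fintype.card V) (m := M.card)
    (x := (uncovered U M).card) (u := U.card) (h := h) (t := t) hη (by positivity) (by positivity)
    (lt_of_lt_of_le (lt_trans (by positivity) hn₀) hn₀n) ?_ hU ?_ ht ?_ (by positivity)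
    (hn₀.trans_le hn₀n) ?_ (hlow.trans ?_)
  · exact_mod_cast hM.card_add_card_add_card_uncovered hH
  · exact hK.trans (by exact_mod_cast hlt)
  · exact_mod_cast (show 0 < t by exact_mod_cast ht0)
  · exact_mod_cast hht t
  · exact_mod_cast hcount

end Hypergraph

/-- Hàn–Person–Schacht: For every `η > 0` there is `n₀` such that every
3-uniform hypergraph on `n > n₀` vertices, `3 ∣ n`, in which every vertex lies in at
least `(5/9 + η) * C(n,2)` edges, contains a perfect matching. -/
theorem min_degree_perfect_matching :
    ∀ η : ℝ, 0 < η → ∃ n₀ : ℕ, ∀ n : ℕ, n > n₀ → 3 ∣ n →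
    ∀ (V : Type) (_ : Fintype V) (_ : DecidableEq V), Fintype.card V = n →
    ∀ H : Finset (Finset V), (∀ e ∈ H, e.card = 3) →
    (∀ x : V, ((H.filter (fun e => x ∈ e)).card : ℝ) ≥ (5 / 9 + η) * (n.choose 2)) →
    ∃ M ⊆ H, (∀ e ∈ M, ∀ f ∈ M, e ≠ f → Disjoint e f) ∧ (∀ v : V, ∃ e ∈ M, v ∈ e) := by
  intro η hη
  obtain ⟨K, n₁, hbound⟩ := exists_bound_uncovered hη
  obtain ⟨n₂, habsorb⟩ := exists_absorbing_family hη K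
  refine ⟨n₁ + n₂, ?_⟩
  rintro n hn hdvd V _ _ rfl H hH hdeg
  have hlink : ∀ x, (5 / 9 + η) * (Fintype.card V * (Fintype.card V - 1)) ≤
      ((linkPairs H x).card : ℝ) := by
    intro x
    have h1 := hdeg x
    rw [Nat.cast_choose_two] at h1
    have h2 : (2 * (H.filter fun e => x ∈ e).card : ℝ) ≤ (linkPairs H x).card := by
      exact_mod_cast two_mul_degree_le_card_linkPairs hH x
    linarith
  obtain ⟨A, hAd, hA, hAU, hAT⟩ := habsorb V (by omega) H hH hlink
  obtain ⟨M, hM⟩ := exists_isMaxMatchingAvoiding H (A.biUnion id)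
  have hX := hbound V (by omega) H hH hlink _ M hAU hM
  have hcard := hM.card_add_card_add_card_uncovered hH
  have hU : (A.biUnion id).card = A.card * 6 := by
    rw [card_biUnion hAd, sum_const_nat (m := 6)]
    exact fun P hP => (hA P hP).1
  obtain ⟨k, hk⟩ : 3 ∣ (uncovered (A.biUnion id) M).card := by omega
  have hUX := isMatchable_union_of_absorbers k A _ hAd (fun P hP => (hA P hP).2)
    (disjoint_sdiff.mono_left subset_union_left) hk
    (fun T hT => le_trans (by omega) (hAT T hT))
  have hall := hUX.union (T := M.biUnion id) ⟨M, hM.subset, hM.disjoint, rfl⟩ (by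
    rw [disjoint_union_left]
    exact ⟨hM.disjoint_biUnion, sdiff_disjoint.mono_right subset_union_right⟩)
  obtain ⟨N, hN, hNd, hNU⟩ := hall
  refine ⟨N, hN, fun e he f hf hne => hNd he hf hne, fun v => ?_⟩
  have hv : v ∈ N.biUnion id := by
    rw [hNU]
    simp only [mem_union, mem_sdiff, mem_univ, true_and]
    tauto
  simpa using hv
end

section
/- For all γ > 0 there is t_0 such that the following holds: if H is a 3-uniform hypergraph with t > t_0 vertices and at least (1-γ)·C(t,3) edges, then for every 2-colouring of the edges of H there exist two vertex-disjoint monochromatic connected matchings, of distinct colours, covering at least (1 - 290γ^{1/6})·t vertices of H. -/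
open Finset
open scoped Classical

/-- Pseudo-path connectivity of edges inside the hypergraph `G`. -/
def PseudoConn {V : Type*} [DecidableEq V] (G : Finset (Finset V))
    (e f : Finset V) : Prop :=
  ∃ p : List (Finset V), p ≠ [] ∧ p.head? = some e ∧ p.getLast? = some f ∧
    (∀ g ∈ p, g ∈ G) ∧ p.Chain' (fun a b => (a ∩ b).card = 2)

/-- A matching: pairwise disjoint edges. -/
def IsMatching {V : Type*} [DecidableEq V] (M : Finset (Finset V)) : Prop :=
  ∀ e ∈ M, ∀ f ∈ M, e ≠ f → Disjoint e f

/-- A connected matching, monochromatic in the colour class `G`: a matching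
`M ⊆ G` each two of whose edges are joined by a pseudo-path within `G`. -/
def IsConnectedMatchingIn {V : Type*} [DecidableEq V]
    (G M : Finset (Finset V)) : Prop :=
  M ⊆ G ∧ IsMatching M ∧ ∀ e ∈ M, ∀ f ∈ M, PseudoConn G e f

/-- Two edges of `G` are adjacent when they share exactly two vertices. -/
def TightAdj {V : Type*} [DecidableEq V] (G : Finset (Finset V)) (a b : Finset V) : Prop :=
  a ∈ G ∧ b ∈ G ∧ (a ∩ b).card = 2

/-- Being in the same tight component of `G`. -/
def TightConn {V : Type*} [DecidableEq V] (G : Finset (Finset V)) : Finset V → Finset V → Prop :=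
  Relation.ReflTransGen (TightAdj G)

theorem reflTransGen_symm {α : Type*} {r : α → α → Prop} (hr : ∀ x y, r x y → r y x) {x y : α}
    (h : Relation.ReflTransGen r x y) : Relation.ReflTransGen r y x :=
  have : Std.Symm r := ⟨hr⟩
  Relation.ReflTransGen.stdSymm.symm x y h

theorem TightConn.symm {V : Type*} [DecidableEq V] {G : Finset (Finset V)} {e f : Finset V}
    (h : TightConn G e f) : TightConn G f e := by
  refine reflTransGen_symm ?_ h
  rintro a b ⟨ha, hb, hab⟩
  exact ⟨hb, ha, by rwa [Finset.inter_comm]⟩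

theorem TightConn.trans {V : Type*} [DecidableEq V] {G : Finset (Finset V)} {e f g : Finset V}
    (h : TightConn G e f) (h' : TightConn G f g) : TightConn G e g :=
  Relation.ReflTransGen.trans h h'

theorem TightConn.pseudoConn {V : Type*} [DecidableEq V] {G : Finset (Finset V)} {e f : Finset V}
    (hf : f ∈ G) (h : TightConn G e f) : PseudoConn G e f := by
  induction h using Relation.ReflTransGen.head_induction_on with
  | refl => exact ⟨[f], by simp, by simp, by simp, by simpa using hf,
      List.isChain_singleton _⟩
  | @head a c hac _ ih =>
    obtain ⟨p, hp, hh, hl, hG, hc⟩ := ih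
    cases p with
    | nil => exact absurd rfl hp
    | cons c' q =>
      obtain rfl : c' = c := by simpa using hh
      refine ⟨a :: c' :: q, by simp, by simp, by simpa using hl, ?_, ?_⟩
      · intro g hg
        rcases List.mem_cons.1 hg with rfl | hg
        · exact hac.1
        · exact hG g hg
      · exact List.isChain_cons_cons.2 ⟨hac.2.2, hc⟩

theorem tightConn_of_common_pair {V : Type*} [DecidableEq V] {G : Finset (Finset V)}
    (hG : ∀ e ∈ G, e.card = 3) {e f : Finset V} (he : e ∈ G) (hf : f ∈ G) {v x : V} (hvx : v ≠ x)
    (hve : v ∈ e) (hxe : x ∈ e) (hvf : v ∈ f) (hxf : x ∈ f) : TightConn G e f := by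
  by_cases hef : e = f
  · subst hef; exact Relation.ReflTransGen.refl
  refine Relation.ReflTransGen.single ⟨he, hf, ?_⟩
  have h2 : 2 ≤ (e ∩ f).card := by
    rw [← Finset.card_pair hvx]
    apply Finset.card_le_card
    intro y hy
    simp only [Finset.mem_insert, Finset.mem_singleton] at hy
    rcases hy with rfl | rfl <;> simp [*]
  have h3 : (e ∩ f).card < 3 := by
    by_contra hcon
    push Not at hcon
    have h1 : e ∩ f = e := Finset.eq_of_subset_of_card_le Finset.inter_subset_left
      (by rw [hG e he]; exact hcon)
    have h2 : e ∩ f = f := Finset.eq_of_subset_of_card_le Finset.inter_subset_right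
      (by rw [hG f hf]; exact hcon)
    exact hef (h1.symm.trans h2)
  omega

theorem exists_mem_avoiding {V : Type*} [DecidableEq V] {U S : Finset V} (h : S.card < U.card) :
    ∃ u ∈ U, u ∉ S := Finset.exists_mem_notMem_of_card_lt_card h

theorem exists_connected_part_of_many_neighbours {V : Type*} [DecidableEq V]
    {r b : V → V → Prop} (hr : ∀ x y, r x y → r y x) (hb : ∀ x y, b x y → b y x) {Y : Finset V} {k : ℕ}
    (hY : ∀ y ∈ Y, (Y.filter fun z => ¬ (r y z ∨ b y z)).card ≤ k) {x : V} (hx : x ∈ Y)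
    (hdeg : k < (Y.filter fun z => r x z).card) :
    ∃ A ⊆ Y, Y.card ≤ A.card + 2 * k ∧
      ((∀ y ∈ A, ∃ z, r y z) ∧ (∀ y ∈ A, ∀ z ∈ A, Relation.ReflTransGen r y z) ∨
       (∀ y ∈ A, ∃ z, b y z) ∧ (∀ y ∈ A, ∀ z ∈ A, Relation.ReflTransGen b y z)) := by
  set C := Y.filter fun y => Relation.ReflTransGen r x y with hC
  set D := Y.filter fun y => ¬ Relation.ReflTransGen r x y with hD
  have hcard : C.card + D.card = Y.card := Finset.card_filter_add_card_filter_not _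
  have hCk : k < C.card := by
    refine lt_of_lt_of_le hdeg (Finset.card_le_card ?_)
    intro z hz
    simp only [Finset.mem_filter, hC] at hz ⊢
    exact ⟨hz.1, Relation.ReflTransGen.single hz.2⟩
  by_cases hDk : D.card ≤ 2 * k
  · refine ⟨C, Finset.filter_subset _ _, by omega, Or.inl ⟨?_, ?_⟩⟩
    · intro y hy
      have hy' := (Finset.mem_filter.1 hy).2
      rcases Relation.ReflTransGen.cases_tail hy' with h | ⟨c, -, hc⟩
      · subst h
        obtain ⟨z, hz⟩ := Finset.card_pos.1 (lt_of_le_of_lt (Nat.zero_le _) hdeg)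
        exact ⟨z, (Finset.mem_filter.1 hz).2⟩
      · exact ⟨c, hr _ _ hc⟩
    · intro y hy z hz
      exact (reflTransGen_symm hr (Finset.mem_filter.1 hy).2).trans (Finset.mem_filter.1 hz).2
  push Not at hDk
  have cross : ∀ c ∈ C, ∀ d ∈ D, ¬ r c d := by
    intro c hc d hd hcd
    exact (Finset.mem_filter.1 hd).2 ((Finset.mem_filter.1 hc).2.tail hcd)
  have toC : ∀ d ∈ D, ∃ c ∈ C, b d c := by
    intro d hd
    obtain ⟨c, hc, hcn⟩ := exists_mem_avoiding
      (lt_of_le_of_lt (hY d (Finset.mem_filter.1 hd).1) hCk)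
    refine ⟨c, hc, ?_⟩
    have hcY := (Finset.mem_filter.1 hc).1
    simp only [Finset.mem_filter, hcY, true_and, not_not] at hcn
    exact hcn.resolve_left fun h => cross c hc d hd (hr _ _ h)
  have inC : ∀ c ∈ C, ∀ c' ∈ C, ∃ d, b c d ∧ b c' d := by
    intro c hc c' hc'
    obtain ⟨d, hd, hdn⟩ := exists_mem_avoiding (U := D)
      (S := (Y.filter fun z => ¬ (r c z ∨ b c z)) ∪ (Y.filter fun z => ¬ (r c' z ∨ b c' z))) (by
        have h1 := hY c (Finset.mem_filter.1 hc).1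
        have h2 := hY c' (Finset.mem_filter.1 hc').1
        have h3 := Finset.card_union_le (Y.filter fun z => ¬ (r c z ∨ b c z))
          (Y.filter fun z => ¬ (r c' z ∨ b c' z))
        omega)
    have hdY := (Finset.mem_filter.1 hd).1
    simp only [Finset.mem_union, Finset.mem_filter, hdY, true_and, not_or] at hdn
    have n1 := cross c hc d hd
    have n2 := cross c' hc' d hd
    exact ⟨d, by tauto, by tauto⟩
  have conC : ∀ c ∈ C, ∀ c' ∈ C, Relation.ReflTransGen b c c' := by
    intro c hc c' hc'
    obtain ⟨d, h1, h2⟩ := inC c hc c' hc'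
    exact (Relation.ReflTransGen.single h1).tail (hb _ _ h2)
  have reach : ∀ y ∈ Y, ∃ c ∈ C, Relation.ReflTransGen b y c := by
    intro y hy
    by_cases hyC : Relation.ReflTransGen r x y
    · exact ⟨y, Finset.mem_filter.2 ⟨hy, hyC⟩, Relation.ReflTransGen.refl⟩
    · obtain ⟨c, hc, h⟩ := toC y (Finset.mem_filter.2 ⟨hy, hyC⟩)
      exact ⟨c, hc, Relation.ReflTransGen.single h⟩
  refine ⟨Y, subset_rfl, by omega, Or.inr ⟨?_, ?_⟩⟩
  · intro y hy
    by_cases hyC : Relation.ReflTransGen r x y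
    · obtain ⟨d, h, -⟩ := inC y (Finset.mem_filter.2 ⟨hy, hyC⟩) y (Finset.mem_filter.2 ⟨hy, hyC⟩)
      exact ⟨d, h⟩
    · obtain ⟨c, hc, h⟩ := toC y (Finset.mem_filter.2 ⟨hy, hyC⟩)
      exact ⟨c, h⟩
  · intro y hy z hz
    obtain ⟨c, hc, h⟩ := reach y hy
    obtain ⟨c', hc', h'⟩ := reach z hz
    exact (h.trans (conC c hc c' hc')).trans (reflTransGen_symm hb h')

theorem exists_large_monochromatic_connected_part {V : Type*} [DecidableEq V]
    {r b : V → V → Prop} (hr : ∀ x y, r x y → r y x) (hb : ∀ x y, b x y → b y x) {Y : Finset V} {k : ℕ}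
    (hY : ∀ y ∈ Y, (Y.filter fun z => ¬ (r y z ∨ b y z)).card ≤ k) (hk : 3 * k < Y.card) :
    ∃ A ⊆ Y, Y.card ≤ A.card + 2 * k ∧
      ((∀ y ∈ A, ∃ z, r y z) ∧ (∀ y ∈ A, ∀ z ∈ A, Relation.ReflTransGen r y z) ∨
       (∀ y ∈ A, ∃ z, b y z) ∧ (∀ y ∈ A, ∀ z ∈ A, Relation.ReflTransGen b y z)) := by
  obtain ⟨x, hx⟩ := Finset.card_pos.1 (lt_of_le_of_lt (Nat.zero_le _) hk)
  by_cases h1 : k < (Y.filter fun z => r x z).card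
  · exact exists_connected_part_of_many_neighbours hr hb hY hx h1
  by_cases h2 : k < (Y.filter fun z => b x z).card
  · obtain ⟨A, hA, hc, h⟩ := exists_connected_part_of_many_neighbours hb hr
      (fun y hy => by simpa only [or_comm] using hY y hy) hx h2
    exact ⟨A, hA, hc, h.symm⟩
  exfalso
  have h3 := hY x hx
  have hsub : Y ⊆ ((Y.filter fun z => r x z) ∪ (Y.filter fun z => b x z)) ∪
      (Y.filter fun z => ¬ (r x z ∨ b x z)) := by
    intro z hz
    simp only [Finset.mem_union, Finset.mem_filter, hz, true_and]
    tauto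
  have h4 := Finset.card_le_card hsub
  have h5 := Finset.card_union_le ((Y.filter fun z => r x z) ∪ (Y.filter fun z => b x z))
    (Y.filter fun z => ¬ (r x z ∨ b x z))
  have h6 := Finset.card_union_le (Y.filter fun z => r x z) (Y.filter fun z => b x z)
  omega

/-- The edges of `G` in the tight component of some edge that contains an `N`-pair meeting `S`. -/
noncomputable def seededComponent {V : Type*} [DecidableEq V] (G : Finset (Finset V))
    (S : Finset V) (N : V → V → Prop) : Finset (Finset V) :=
  G.filter fun e => ∃ s ∈ G, ∃ v ∈ S, ∃ w, N v w ∧ v ∈ s ∧ w ∈ s ∧ TightConn G s e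

theorem seededComponent_subset {V : Type*} [DecidableEq V] (G : Finset (Finset V))
    (S : Finset V) (N : V → V → Prop) : seededComponent G S N ⊆ G :=
  Finset.filter_subset _ _

theorem mem_seededComponent_of_pair {V : Type*} [DecidableEq V] {G : Finset (Finset V)}
    {S : Finset V} {N : V → V → Prop} {e : Finset V} (he : e ∈ G) {v w : V} (hv : v ∈ S)
    (hN : N v w) (hve : v ∈ e) (hwe : w ∈ e) : e ∈ seededComponent G S N :=
  Finset.mem_filter.2 ⟨he, e, he, v, hv, w, hN, hve, hwe, Relation.ReflTransGen.refl⟩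

theorem mem_seededComponent_of_common_pair {V : Type*} [DecidableEq V] {G : Finset (Finset V)}
    (hG : ∀ e ∈ G, e.card = 3) {S : Finset V} {N : V → V → Prop} {e f : Finset V}
    (he : e ∈ seededComponent G S N) (hf : f ∈ G) {x y : V} (hxy : x ≠ y)
    (hxe : x ∈ e) (hye : y ∈ e) (hxf : x ∈ f) (hyf : y ∈ f) : f ∈ seededComponent G S N := by
  obtain ⟨heG, s, hs, v, hv, w, hN, hvs, hws, hc⟩ := Finset.mem_filter.1 he
  exact Finset.mem_filter.2 ⟨hf, s, hs, v, hv, w, hN, hvs, hws,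
    hc.trans (tightConn_of_common_pair hG heG hf hxy hxe hye hxf hyf)⟩

/-- A set of three vertices of `W`, pairwise related by `N`. -/
def IsTriangleIn {V : Type*} (N : V → V → Prop) (W e : Finset V) : Prop :=
  e ⊆ W ∧ e.card = 3 ∧ ∀ x ∈ e, ∀ y ∈ e, x ≠ y → N x y

/-- A two-coloured hypergraph, almost complete on `VR ∪ VB`, in which the red edges containing an
`N`-pair that meets `VR` lie in one tight component, as do the blue edges containing an `N`-pair
that meets `VB`; each vertex and each `N`-pair has at most `k` exceptions. -/
structure CleanColouring {V : Type*} [Fintype V] [DecidableEq V] (Hr Hb : Finset (Finset V))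
    (VR VB : Finset V) (N : V → V → Prop) (k : ℕ) : Prop where
  card_red : ∀ e ∈ Hr, e.card = 3
  card_blue : ∀ e ∈ Hb, e.card = 3
  disjoint_colours : Disjoint Hr Hb
  symm : ∀ v w, N v w → N w v
  ne : ∀ v w, N v w → v ≠ w
  card_nonadj : ∀ v ∈ VR ∪ VB, ((VR ∪ VB).filter fun w => ¬ N v w).card ≤ k
  card_missing : ∀ v w, N v w →
    (Finset.univ.filter fun z => ({v, w, z} : Finset V) ∉ Hr ∪ Hb).card ≤ k
  conn_red : ∀ v ∈ VR, ∀ v' ∈ VR, ∀ w w', N v w → N v' w' → ∀ e ∈ Hr, ∀ e' ∈ Hr,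
    v ∈ e → w ∈ e → v' ∈ e' → w' ∈ e' → TightConn Hr e e'
  conn_blue : ∀ v ∈ VB, ∀ v' ∈ VB, ∀ w w', N v w → N v' w' → ∀ e ∈ Hb, ∀ e' ∈ Hb,
    v ∈ e → w ∈ e → v' ∈ e' → w' ∈ e' → TightConn Hb e e'

theorem tightConn_of_mem_seededComponent {V : Type*} [DecidableEq V] {G : Finset (Finset V)}
    {S : Finset V} {N : V → V → Prop}
    (hG : ∀ v ∈ S, ∀ v' ∈ S, ∀ w w', N v w → N v' w' → ∀ e ∈ G, ∀ e' ∈ G,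
      v ∈ e → w ∈ e → v' ∈ e' → w' ∈ e' → TightConn G e e') {e f : Finset V}
    (he : e ∈ seededComponent G S N) (hf : f ∈ seededComponent G S N) : TightConn G e f := by
  obtain ⟨-, s, hs, v, hv, w, hN, hvs, hws, hc⟩ := Finset.mem_filter.1 he
  obtain ⟨-, s', hs', v', hv', w', hN', hvs', hws', hc'⟩ := Finset.mem_filter.1 hf
  exact (hc.symm.trans (hG v hv v' hv' w w' hN hN' s hs s' hs' hvs hws hvs' hws')).trans hc'

theorem exists_max_weight_matching {V : Type*} [DecidableEq V] (T : Finset (Finset V))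
    (hT : ∀ e ∈ T, e.Nonempty) (weight : Finset V → ℕ) :
    ∃ M ⊆ T, IsMatching M ∧ ∀ A ⊆ M, ∀ A' ⊆ T, IsMatching A' →
      (∀ e ∈ A', ∀ x ∈ e, x ∈ A.biUnion id ∨ x ∉ M.biUnion id) →
      ∑ e ∈ A', weight e ≤ ∑ e ∈ A, weight e := by
  obtain ⟨M, hM, hmax⟩ := Finset.exists_max_image
    (T.powerset.filter fun M => IsMatching M) (fun M => ∑ e ∈ M, weight e)
    ⟨∅, Finset.mem_filter.2 ⟨Finset.empty_mem_powerset _, by intro e he; simp at he⟩⟩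
  simp only [Finset.mem_filter, Finset.mem_powerset] at hM hmax
  refine ⟨M, hM.1, hM.2, fun A hA A' hA' hm hx => ?_⟩
  have key : ∀ e ∈ M \ A, ∀ f ∈ A', Disjoint e f := by
    intro e he f hf
    rw [Finset.disjoint_left]
    intro x hxe hxf
    rw [Finset.mem_sdiff] at he
    rcases hx f hf x hxf with h | h
    · simp only [Finset.mem_biUnion, id] at h
      obtain ⟨a, ha, hxa⟩ := h
      have hne : e ≠ a := fun h => he.2 (h ▸ ha)
      exact Finset.disjoint_left.1 (hM.2 e he.1 a (hA ha) hne) hxe hxa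
    · exact h (Finset.mem_biUnion.2 ⟨e, he.1, hxe⟩)
  have hdisj : Disjoint (M \ A) A' := by
    rw [Finset.disjoint_left]
    intro e he he'
    obtain ⟨x, hxe⟩ := hT e (hA' he')
    exact Finset.disjoint_left.1 (key e he e he') hxe hxe
  have h := hmax (M \ A ∪ A') ⟨Finset.union_subset (Finset.sdiff_subset.trans hM.1) hA', by
    intro e he f hf hne
    rw [Finset.mem_union] at he hf
    rcases he with he | he <;> rcases hf with hf | hf
    · exact hM.2 e (Finset.mem_sdiff.1 he).1 f (Finset.mem_sdiff.1 hf).1 hne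
    · exact key e he f hf
    · exact (key f hf e he).symm
    · exact hm e he f hf hne⟩
  rw [Finset.sum_union hdisj] at h
  have h' := Finset.sum_sdiff (f := weight) hA
  omega

theorem isMatching_singleton {V : Type*} [DecidableEq V] (e : Finset V) :
    IsMatching ({e} : Finset (Finset V)) := by
  intro a ha b hb hne
  rw [Finset.mem_singleton] at ha hb
  exact absurd (ha.trans hb.symm) hne

theorem card_biUnion_of_isMatching {V : Type*} [DecidableEq V] {M : Finset (Finset V)}
    (hM : IsMatching M) (h3 : ∀ e ∈ M, e.card = 3) : (M.biUnion id).card = 3 * M.card := by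
  have h : ∑ e ∈ M, (id e).card = ∑ _e ∈ M, 3 := Finset.sum_congr rfl h3
  rw [Finset.card_biUnion (t := id) (fun e he f hf hne => hM e he f hf hne), h]
  simp [mul_comm]

namespace CleanColouring

variable {V : Type*} [Fintype V] [DecidableEq V] {Hr Hb : Finset (Finset V)}
  {VR VB : Finset V} {N : V → V → Prop} {k : ℕ}

theorem isTriangleIn (h : CleanColouring Hr Hb VR VB N k) {W : Finset V} {v w u : V}
    (hv : v ∈ W) (hw : w ∈ W) (hu : u ∈ W) (hvw : N v w) (hvu : N v u) (hwu : N w u) :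
    IsTriangleIn N W {v, w, u} := by
  refine ⟨?_, Finset.card_eq_three.2 ⟨v, w, u, h.ne _ _ hvw, h.ne _ _ hvu, h.ne _ _ hwu, rfl⟩, ?_⟩
  · intro x hx
    simp only [Finset.mem_insert, Finset.mem_singleton] at hx
    rcases hx with rfl | rfl | rfl <;> assumption
  · intro x hx y hy hne
    have h1 := h.symm _ _ hvw
    have h2 := h.symm _ _ hvu
    have h3 := h.symm _ _ hwu
    simp only [Finset.mem_insert, Finset.mem_singleton] at hx hy
    rcases hx with rfl | rfl | rfl <;> rcases hy with rfl | rfl | rfl <;>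
      first | assumption | exact absurd rfl hne

theorem exists_neighbour (h : CleanColouring Hr Hb VR VB N k) {U F : Finset V}
    (hU : U ⊆ VR ∪ VB) {v : V} (hv : v ∈ VR ∪ VB) (hc : k + F.card < U.card) :
    ∃ u ∈ U, u ∉ F ∧ N v u := by
  obtain ⟨u, hu, hn⟩ := exists_mem_avoiding (U := U)
    (S := ((VR ∪ VB).filter fun w => ¬ N v w) ∪ F) (by
      have h1 := h.card_nonadj v hv
      have h2 := Finset.card_union_le ((VR ∪ VB).filter fun w => ¬ N v w) F
      omega)
  have huW := hU hu
  rw [Finset.mem_union, Finset.mem_filter] at hn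
  exact ⟨u, hu, by tauto, by tauto⟩

theorem exists_extension (h : CleanColouring Hr Hb VR VB N k) {U F : Finset V}
    (hU : U ⊆ VR ∪ VB) {v w : V} (hv : v ∈ VR ∪ VB) (hw : w ∈ VR ∪ VB) (hvw : N v w)
    (hc : 3 * k + F.card < U.card) :
    ∃ u ∈ U, u ∉ F ∧ N v u ∧ N w u ∧ ({v, w, u} : Finset V) ∈ Hr ∪ Hb := by
  obtain ⟨u, hu, hn, hvu⟩ := h.exists_neighbour (U := U) (v := v) hU hv
    (F := ((VR ∪ VB).filter fun x => ¬ N w x) ∪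
      ((Finset.univ.filter fun z => ({v, w, z} : Finset V) ∉ Hr ∪ Hb) ∪ F)) (by
      have h1 := h.card_nonadj w hw
      have h2 := h.card_missing v w hvw
      have h3 := Finset.card_union_le ((VR ∪ VB).filter fun x => ¬ N w x)
        ((Finset.univ.filter fun z => ({v, w, z} : Finset V) ∉ Hr ∪ Hb) ∪ F)
      have h4 := Finset.card_union_le
        (Finset.univ.filter fun z => ({v, w, z} : Finset V) ∉ Hr ∪ Hb) F
      omega)
  have huW := hU hu
  rw [Finset.mem_union, Finset.mem_union, Finset.mem_filter, Finset.mem_filter] at hn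
  have huv := Finset.mem_univ u
  exact ⟨u, hu, by tauto, hvu, by tauto, by tauto⟩

theorem exists_triangle (h : CleanColouring Hr Hb VR VB N k) {U F : Finset V}
    (hU : U ⊆ VR ∪ VB) {v : V} (hv : v ∈ VR ∪ VB) (hc : 3 * k + F.card < U.card) :
    ∃ u ∈ U, u ∉ F ∧ ∃ u' ∈ U, u' ∉ F ∧ N v u ∧ N v u' ∧ N u u' ∧
      ({v, u, u'} : Finset V) ∈ Hr ∪ Hb := by
  obtain ⟨u, hu, huF, hvu⟩ := h.exists_neighbour hU hv (F := F) (by omega)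
  obtain ⟨u', hu', huF', h1, h2, h3⟩ := h.exists_extension hU hv (hU hu) hvu hc
  exact ⟨u, hu, huF, u', hu', huF', hvu, h1, h2, h3⟩

/-- In a clean colouring, the blue triangles inside a set all of whose triangles are blue cover
almost all of it by a connected matching. -/
theorem exists_matching_of_forall_blue (h : CleanColouring Hr Hb VR VB N k) {U : Finset V}
    (hU : U ⊆ VR ∪ VB) (hc : 6 * k < U.card)
    (hblue : ∀ e ∈ Hr ∪ Hb, IsTriangleIn N U e → e ∈ Hb) :
    ∃ M, IsConnectedMatchingIn Hb M ∧ M.biUnion id ⊆ U ∧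
      U.card ≤ (M.biUnion id).card + (3 * k + 3) := by
  obtain ⟨M, hMT, hM, hmax⟩ := exists_max_weight_matching
    (Hb.filter fun e => IsTriangleIn N U e)
    (fun e he => Finset.card_pos.1 (by rw [(Finset.mem_filter.1 he).2.2.1]; norm_num))
    (fun _ => 1)
  have hMU : M.biUnion id ⊆ U := by
    intro x hx
    simp only [Finset.mem_biUnion, id] at hx
    obtain ⟨e, he, hxe⟩ := hx
    exact (Finset.mem_filter.1 (hMT he)).2.1 hxe
  refine ⟨M, ⟨fun e he => (Finset.mem_filter.1 (hMT he)).1, hM, ?_⟩, hMU, ?_⟩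
  · intro e he f hf
    obtain ⟨heb, heU, he3, heN⟩ := Finset.mem_filter.1 (hMT he)
    obtain ⟨hfb, hfU, hf3, hfN⟩ := Finset.mem_filter.1 (hMT hf)
    refine TightConn.pseudoConn hfb ?_
    obtain ⟨x, hx, y, hy, hxy⟩ := Finset.one_lt_card.1 (by omega : 1 < e.card)
    obtain ⟨x', hx', y', hy', hxy'⟩ := Finset.one_lt_card.1 (by omega : 1 < f.card)
    have W : ∀ z ∈ U, z ∈ VR ∪ VB := fun z hz => hU hz
    have hNxy := heN x hx y hy hxy
    have hNxy' := hfN x' hx' y' hy' hxy'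
    have avoid : ∀ a b, N a b → a ∈ U → b ∈ U →
        (((VR ∪ VB).filter fun z => ¬ N a z) ∪ (((VR ∪ VB).filter fun z => ¬ N b z) ∪
          (Finset.univ.filter fun z => ({a, b, z} : Finset V) ∉ Hr ∪ Hb))).card ≤ 3 * k := by
      intro a b hab ha hb
      have h1 := h.card_nonadj a (W a ha)
      have h2 := h.card_nonadj b (W b hb)
      have h3 := h.card_missing a b hab
      have h4 := Finset.card_union_le ((VR ∪ VB).filter fun z => ¬ N a z)
        (((VR ∪ VB).filter fun z => ¬ N b z) ∪
          (Finset.univ.filter fun z => ({a, b, z} : Finset V) ∉ Hr ∪ Hb))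
      have h5 := Finset.card_union_le ((VR ∪ VB).filter fun z => ¬ N b z)
          (Finset.univ.filter fun z => ({a, b, z} : Finset V) ∉ Hr ∪ Hb)
      omega
    have common : ∀ a b a' b', N a b → N a' b' → a ∈ U → b ∈ U → a' ∈ U → b' ∈ U →
        ∃ u ∈ U, N a u ∧ N b u ∧ N a' u ∧ N b' u ∧ ({a, b, u} : Finset V) ∈ Hb ∧
          ({a', b', u} : Finset V) ∈ Hb := by
      intro a b a' b' hab hab' ha hb ha' hb'
      obtain ⟨u, hu, huF, hau, hbu, habu⟩ := h.exists_extension hU (W a ha) (W b hb) hab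
        (F := ((VR ∪ VB).filter fun z => ¬ N a' z) ∪ (((VR ∪ VB).filter fun z => ¬ N b' z) ∪
          (Finset.univ.filter fun z => ({a', b', z} : Finset V) ∉ Hr ∪ Hb))) (by
        have := avoid a' b' hab' ha' hb'
        omega)
      rw [Finset.mem_union, Finset.mem_union, Finset.mem_filter, Finset.mem_filter,
        Finset.mem_filter] at huF
      have huW := W u hu
      have huv := Finset.mem_univ u
      have n1 : N a' u := by tauto
      have n2 : N b' u := by tauto
      have n3 : ({a', b', u} : Finset V) ∈ Hr ∪ Hb := by tauto
      exact ⟨u, hu, hau, hbu, n1, n2, hblue _ habu (h.isTriangleIn ha hb hu hab hau hbu),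
        hblue _ n3 (h.isTriangleIn ha' hb' hu hab' n1 n2)⟩
    obtain ⟨u, hu, hxu, -, hxu', -, e1, e4⟩ := common x y x' y' hNxy hNxy' (heU hx) (heU hy)
      (hfU hx') (hfU hy')
    obtain ⟨w, -, -, -, -, -, e2, e3⟩ := common x u x' u hxu hxu' (heU hx) hu (hfU hx') hu
    have c := @tightConn_of_common_pair V _ Hb h.card_blue
    have c1 : TightConn Hb e {x, y, u} := c heb e1 hxy hx hy (by simp) (by simp)
    have c2 : TightConn Hb {x, y, u} {x, u, w} :=
      c e1 e2 (h.ne _ _ hxu) (by simp) (by simp) (by simp) (by simp)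
    have c4 : TightConn Hb {x', u, w} {x', y', u} :=
      c e3 e4 (h.ne _ _ hxu') (by simp) (by simp) (by simp) (by simp)
    have c5 : TightConn Hb {x', y', u} f := c e4 hfb hxy' (by simp) (by simp) hx' hy'
    have hwu : u ≠ w := by
      rintro rfl
      have := h.card_blue _ e2
      have h2 : ({x, u, u} : Finset V).card ≤ 2 := by
        rw [Finset.pair_eq_singleton]
        exact Finset.card_le_two
      omega
    have c3 : TightConn Hb {x, u, w} {x', u, w} :=
      c e2 e3 hwu (by simp) (by simp) (by simp) (by simp)
    exact (((c1.trans c2).trans c3).trans c4).trans c5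
  · by_contra hcon
    push Not at hcon
    have hsd := Finset.card_sdiff_add_card_eq_card hMU
    have hsub : U \ M.biUnion id ⊆ VR ∪ VB := Finset.sdiff_subset.trans hU
    obtain ⟨v, hv⟩ := Finset.card_pos.1 (by omega : 0 < (U \ M.biUnion id).card)
    obtain ⟨u, hu, -, u', hu', -, h1, h2, h3, h4⟩ := h.exists_triangle hsub (hsub hv) (F := ∅)
      (by rw [Finset.card_empty]; omega)
    have htri := h.isTriangleIn hv hu hu' h1 h2 h3
    have htU : IsTriangleIn N U {v, u, u'} := ⟨htri.1.trans Finset.sdiff_subset, htri.2⟩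
    have := hmax ∅ (Finset.empty_subset _) {{v, u, u'}} (by
      rw [Finset.singleton_subset_iff]
      exact Finset.mem_filter.2 ⟨hblue _ h4 htU, htU⟩) (isMatching_singleton _) (by
      intro e he x hx
      rw [Finset.mem_singleton] at he
      subst he
      exact Or.inr (Finset.mem_sdiff.1 (htri.1 hx)).2)
    simp at this

end CleanColouring

namespace CleanColouring

variable {V : Type*} [Fintype V] [DecidableEq V] {Hr Hb : Finset (Finset V)}
  {VR VB : Finset V} {N : V → V → Prop} {k : ℕ}

theorem swap (h : CleanColouring Hr Hb VR VB N k) : CleanColouring Hb Hr VB VR N k where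
  card_red := h.card_blue
  card_blue := h.card_red
  disjoint_colours := h.disjoint_colours.symm
  symm := h.symm
  ne := h.ne
  card_nonadj := by
    intro v hv
    rw [Finset.union_comm] at hv ⊢
    exact h.card_nonadj v hv
  card_missing := by
    intro v w hvw
    rw [Finset.union_comm]
    exact h.card_missing v w hvw
  conn_red := h.conn_blue
  conn_blue := h.conn_red

/-- If few vertices are of the second kind, then two disjoint connected matchings of distinct
colours cover almost everything. -/
theorem exists_matchings_of_card_le (h : CleanColouring Hr Hb VR VB N k)
    (hle : VB.card ≤ VR.card) :
    ∃ Mr Mb, IsConnectedMatchingIn Hr Mr ∧ IsConnectedMatchingIn Hb Mb ∧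
      Disjoint (Mr.biUnion id) (Mb.biUnion id) ∧
      (VR ∪ VB).card ≤ (Mr.biUnion id ∪ Mb.biUnion id).card + (10 * k + 10) := by
  obtain ⟨R, hR⟩ : ∃ R, R = seededComponent Hr VR N := ⟨_, rfl⟩
  obtain ⟨B, hB⟩ : ∃ B, B = seededComponent Hb VB N := ⟨_, rfl⟩
  have hRr : R ⊆ Hr := hR ▸ seededComponent_subset _ _ _
  have hBb : B ⊆ Hb := hB ▸ seededComponent_subset _ _ _
  obtain ⟨T, hT⟩ : ∃ T : Finset (Finset V), ∀ e, e ∈ T ↔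
      (e ∈ R ∨ e ∈ B) ∧ IsTriangleIn N (VR ∪ VB) e :=
    ⟨(R ∪ B).filter fun e => IsTriangleIn N (VR ∪ VB) e, by simp⟩
  have hT3 : ∀ e ∈ T, e.card = 3 := fun e he => ((hT e).1 he).2.2.1
  obtain ⟨weight, hweight⟩ : ∃ f : Finset V → ℕ, f = fun e => if e ∈ Hr then 3 else 2 := ⟨_, rfl⟩
  have weight_ge : ∀ e, 2 ≤ weight e := by intro e; rw [hweight]; dsimp only; split_ifs <;> omega
  have weight_le : ∀ e, weight e ≤ 3 := by intro e; rw [hweight]; dsimp only; split_ifs <;> omega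
  have weight_red : ∀ e ∈ Hr, weight e = 3 := fun e he => by
    rw [hweight]; exact if_pos he
  have weight_blue : ∀ e ∈ Hb, weight e = 2 := fun e he => by
    rw [hweight]; exact if_neg fun he' => Finset.disjoint_left.1 h.disjoint_colours he' he
  obtain ⟨M, hMT, hM, hmax⟩ := exists_max_weight_matching T
    (fun e he => Finset.card_pos.1 (by rw [hT3 e he]; norm_num)) weight
  obtain ⟨U, hU⟩ : ∃ U, U = (VR ∪ VB) \ M.biUnion id := ⟨_, rfl⟩
  have hUW : U ⊆ VR ∪ VB := hU ▸ Finset.sdiff_subset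
  have hMW : M.biUnion id ⊆ VR ∪ VB := by
    intro x hx
    simp only [Finset.mem_biUnion, id] at hx
    obtain ⟨e, he, hxe⟩ := hx
    exact ((hT e).1 (hMT he)).2.1 hxe
  have hUcard : U.card + (M.biUnion id).card = (VR ∪ VB).card :=
    hU ▸ Finset.card_sdiff_add_card_eq_card hMW
  have connR : ∀ M' ⊆ M, M' ⊆ R → IsConnectedMatchingIn Hr M' := fun M' h1 h2 =>
    ⟨h2.trans hRr, fun e he f hf => hM e (h1 he) f (h1 hf), fun e he f hf =>
      (tightConn_of_mem_seededComponent h.conn_red (hR ▸ h2 he) (hR ▸ h2 hf)).pseudoConn (hRr (h2 hf))⟩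
  have connB : ∀ M' ⊆ M, M' ⊆ B → IsConnectedMatchingIn Hb M' := fun M' h1 h2 =>
    ⟨h2.trans hBb, fun e he f hf => hM e (h1 he) f (h1 hf), fun e he f hf =>
      (tightConn_of_mem_seededComponent h.conn_blue (hB ▸ h2 he) (hB ▸ h2 hf)).pseudoConn (hBb (h2 hf))⟩
  by_cases hsmall : U.card ≤ 10 * k + 10
  · refine ⟨M.filter (· ∈ Hr), M.filter (· ∉ Hr), connR _ (Finset.filter_subset _ _) ?_,
      connB _ (Finset.filter_subset _ _) ?_, ?_, ?_⟩
    · intro e he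
      obtain ⟨he, her⟩ := Finset.mem_filter.1 he
      rcases ((hT e).1 (hMT he)).1 with h1 | h1
      · exact h1
      · exact absurd (hBb h1) (Finset.disjoint_left.1 h.disjoint_colours her)
    · intro e he
      obtain ⟨he, her⟩ := Finset.mem_filter.1 he
      rcases ((hT e).1 (hMT he)).1 with h1 | h1
      · exact absurd (hRr h1) her
      · exact h1
    · rw [Finset.disjoint_left]
      intro x hx hx'
      simp only [Finset.mem_biUnion, id, Finset.mem_filter] at hx hx'
      obtain ⟨e, ⟨he, her⟩, hxe⟩ := hx
      obtain ⟨f, ⟨hf, hfr⟩, hxf⟩ := hx'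
      exact Finset.disjoint_left.1 (hM e he f hf fun hef => hfr (hef ▸ her)) hxe hxf
    · rw [← Finset.union_biUnion, Finset.filter_union_filter_not_eq]
      omega
  push Not at hsmall
  have useR : ∀ e ∈ Hr, IsTriangleIn N (VR ∪ VB) e → (∃ v ∈ e, v ∈ VR) → e ∈ T := by
    rintro e he htri ⟨v, hve, hv⟩
    obtain ⟨w, hwe, hwv⟩ := Finset.exists_mem_ne (by rw [htri.2.1]; norm_num) v
    exact (hT e).2 ⟨Or.inl (hR ▸ mem_seededComponent_of_pair he hv (htri.2.2 v hve w hwe hwv.symm) hve hwe), htri⟩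
  have useB : ∀ e ∈ Hb, IsTriangleIn N (VR ∪ VB) e → (∃ v ∈ e, v ∈ VB) → e ∈ T := by
    rintro e he htri ⟨v, hve, hv⟩
    obtain ⟨w, hwe, hwv⟩ := Finset.exists_mem_ne (by rw [htri.2.1]; norm_num) v
    exact (hT e).2 ⟨Or.inr (hB ▸ mem_seededComponent_of_pair he hv (htri.2.2 v hve w hwe hwv.symm) hve hwe), htri⟩
  have useRB : ∀ e ∈ Hr ∪ Hb, IsTriangleIn N (VR ∪ VB) e → (∃ v ∈ e, v ∈ VR) →
      (∃ v ∈ e, v ∈ VB) → e ∈ T := by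
    intro e he htri h1 h2
    rcases Finset.mem_union.1 he with he | he
    · exact useR e he htri h1
    · exact useB e he htri h2
  have outside : ∀ x ∈ U, x ∉ M.biUnion id := fun x hx =>
    (Finset.mem_sdiff.1 (hU ▸ hx)).2
  have noadd : ∀ e ∈ T, ¬ e ⊆ U := by
    intro e he heU
    have := hmax ∅ (Finset.empty_subset _) {e} (Finset.singleton_subset_iff.2 he)
      (isMatching_singleton _) (by
        intro f hf x hx
        rw [Finset.mem_singleton] at hf
        subst hf
        exact Or.inr (outside x (heU hx)))
    have h2 := weight_ge e
    simp only [Finset.sum_singleton, Finset.sum_empty] at this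
    omega
  have triple_subset : ∀ {S : Finset V} {a b c : V}, a ∈ S → b ∈ S → c ∈ S →
      ({a, b, c} : Finset V) ⊆ S := by
    intro S a b c ha hb hc x hx
    simp only [Finset.mem_insert, Finset.mem_singleton] at hx
    rcases hx with rfl | rfl | rfl <;> assumption
  -- the uncovered set contains vertices of one kind only
  have hUside : U ⊆ VR ∨ U ⊆ VB := by
    by_contra hcon
    rw [not_or, Finset.not_subset, Finset.not_subset] at hcon
    obtain ⟨⟨x, hxU, hxR⟩, ⟨y, hyU, hyB⟩⟩ := hcon
    have hxB : x ∈ VB := (Finset.mem_union.1 (hUW hxU)).resolve_left hxR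
    have hyR : y ∈ VR := (Finset.mem_union.1 (hUW hyU)).resolve_right hyB
    have hsplit : U ⊆ (U ∩ VR) ∪ (U ∩ VB) := by
      rw [← Finset.inter_union_distrib_left]
      exact Finset.subset_inter subset_rfl hUW
    have hc1 := Finset.card_le_card hsplit
    have hc2 := Finset.card_union_le (U ∩ VR) (U ∩ VB)
    have mixed : ∀ v w, v ∈ U → w ∈ U → N v w → (v ∈ VR ∧ w ∈ VB ∨ v ∈ VB ∧ w ∈ VR) → False := by
      intro v w hv hw hvw hside
      obtain ⟨u, hu, -, hvu, hwu, he⟩ := h.exists_extension hUW (hUW hv) (hUW hw) hvw (F := ∅)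
        (by rw [Finset.card_empty]; omega)
      refine noadd {v, w, u} (useRB _ he (h.isTriangleIn (hUW hv) (hUW hw) (hUW hu) hvw hvu hwu)
        ?_ ?_) (triple_subset hv hw hu)
      · rcases hside with hs | hs
        · exact ⟨v, by simp, hs.1⟩
        · exact ⟨w, by simp, hs.2⟩
      · rcases hside with hs | hs
        · exact ⟨w, by simp, hs.2⟩
        · exact ⟨v, by simp, hs.1⟩
    by_cases hbig : k < (U ∩ VB).card
    · obtain ⟨w, hw, -, hN⟩ := h.exists_neighbour (U := U ∩ VB) (F := ∅)
        (Finset.inter_subset_left.trans hUW) (hUW hyU) (by rw [Finset.card_empty]; omega)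
      exact mixed y w hyU (Finset.mem_inter.1 hw).1 hN (Or.inl ⟨hyR, (Finset.mem_inter.1 hw).2⟩)
    · obtain ⟨w, hw, -, hN⟩ := h.exists_neighbour (U := U ∩ VR) (F := ∅)
        (Finset.inter_subset_left.trans hUW) (hUW hxU) (by rw [Finset.card_empty]; omega)
      exact mixed x w hxU (Finset.mem_inter.1 hw).1 hN (Or.inr ⟨hxB, (Finset.mem_inter.1 hw).2⟩)
  have hUR : U ⊆ VR := by
    refine hUside.resolve_right fun hUB => ?_
    have hnot : ∀ v ∈ U, v ∉ VR := by
      intro v hv hvR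
      obtain ⟨u, hu, -, u', hu', -, h1, h2, h3, h4⟩ := h.exists_triangle hUW (hUW hv) (F := ∅)
        (by rw [Finset.card_empty]; omega)
      exact noadd {v, u, u'} (useRB _ h4 (h.isTriangleIn (hUW hv) (hUW hu) (hUW hu') h1 h2 h3)
        ⟨v, by simp, hvR⟩ ⟨v, by simp, hUB hv⟩) (triple_subset hv hu hu')
    have hVRM : VR ⊆ M.biUnion fun e => e ∩ VR := by
      intro x hx
      have : x ∈ M.biUnion id := by
        by_contra hcon
        refine hnot x ?_ hx
        rw [hU]
        exact Finset.mem_sdiff.2 ⟨Finset.mem_union_left _ hx, hcon⟩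
      simp only [Finset.mem_biUnion, id] at this
      obtain ⟨e, he, hxe⟩ := this
      exact Finset.mem_biUnion.2 ⟨e, he, Finset.mem_inter.2 ⟨hxe, hx⟩⟩
    obtain ⟨e, he, hcard⟩ : ∃ e ∈ M, 1 < (e ∩ VR).card := by
      by_contra hcon
      push Not at hcon
      have h1 := (Finset.card_le_card hVRM).trans
        (Finset.card_biUnion_le_card_mul M (fun e => e ∩ VR) 1 hcon)
      have h2 := card_biUnion_of_isMatching hM fun e he => hT3 e (hMT he)
      have h3 := Finset.card_union_le VR VB
      omega
    obtain ⟨a, ha, a', ha', hne⟩ := Finset.one_lt_card.1 hcard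
    rw [Finset.mem_inter] at ha ha'
    have haW : ∀ x ∈ VR, x ∈ VR ∪ VB := fun x hx => Finset.mem_union_left _ hx
    have hMx : ∀ x ∈ e, x ∉ U := fun x hx hxU =>
      outside x hxU (Finset.mem_biUnion.2 ⟨e, he, hx⟩)
    obtain ⟨u, hu, -, u', hu', -, h1, h2, h3, h4⟩ := h.exists_triangle hUW (haW a ha.2) (F := ∅)
      (by rw [Finset.card_empty]; omega)
    obtain ⟨w, hw, hwF, w', hw', hwF', g1, g2, g3, g4⟩ :=
      h.exists_triangle hUW (haW a' ha'.2) (F := {u, u'})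
        (by have := Finset.card_le_two (a := u) (b := u'); omega)
    have t1 := useRB _ h4 (h.isTriangleIn (haW a ha.2) (hUW hu) (hUW hu') h1 h2 h3)
      ⟨a, by simp, ha.2⟩ ⟨u, by simp, hUB hu⟩
    have t2 := useRB _ g4 (h.isTriangleIn (haW a' ha'.2) (hUW hw) (hUW hw') g1 g2 g3)
      ⟨a', by simp, ha'.2⟩ ⟨w, by simp, hUB hw⟩
    have hdis : Disjoint ({a, u, u'} : Finset V) {a', w, w'} := by
      rw [Finset.disjoint_left]
      intro x hx hx'
      simp only [Finset.mem_insert, Finset.mem_singleton, not_or] at hx hx' hwF hwF'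
      rcases hx with rfl | rfl | rfl <;> rcases hx' with rfl | rfl | rfl <;>
        first
          | exact hne rfl
          | exact hwF.1 rfl
          | exact hwF.2 rfl
          | exact hwF'.1 rfl
          | exact hwF'.2 rfl
          | exact hMx _ ha.1 (by assumption)
          | exact hMx _ ha'.1 (by assumption)
    have hne12 : ({a, u, u'} : Finset V) ≠ {a', w, w'} := by
      intro heq
      rw [heq, Finset.disjoint_self_iff_empty] at hdis
      simp at hdis
    have := hmax {e} (Finset.singleton_subset_iff.2 he) {{a, u, u'}, {a', w, w'}} (by
      intro f hf
      rw [Finset.mem_insert, Finset.mem_singleton] at hf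
      rcases hf with rfl | rfl <;> assumption) (by
      intro f hf g hg hfg
      rw [Finset.mem_insert, Finset.mem_singleton] at hf hg
      rcases hf with rfl | rfl <;> rcases hg with rfl | rfl
      · exact absurd rfl hfg
      · exact hdis
      · exact hdis.symm
      · exact absurd rfl hfg) (by
      intro f hf x hx
      rw [Finset.singleton_biUnion]
      rw [Finset.mem_insert, Finset.mem_singleton] at hf
      rcases hf with rfl | rfl <;> simp only [Finset.mem_insert, Finset.mem_singleton] at hx <;>
        rcases hx with rfl | rfl | rfl <;>
        first
          | exact Or.inl ha.1
          | exact Or.inl ha'.1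
          | exact Or.inr (outside _ (by assumption)))
    rw [Finset.sum_pair hne12, Finset.sum_singleton] at this
    have w1 := weight_ge {a, u, u'}
    have w2 := weight_ge {a', w, w'}
    have w3 := weight_le e
    omega
  have triU : ∀ e ∈ Hr ∪ Hb, IsTriangleIn N U e → e ∈ Hb ∧ e ∉ B := by
    intro e he htri
    have htriW : IsTriangleIn N (VR ∪ VB) e := ⟨htri.1.trans hUW, htri.2⟩
    refine ⟨(Finset.mem_union.1 he).resolve_left fun her => ?_, fun heB => ?_⟩
    · obtain ⟨v, hv⟩ := Finset.card_pos.1 (by rw [htri.2.1]; norm_num : 0 < e.card)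
      exact noadd e (useR e her htriW ⟨v, hv, hUR (htri.1 hv)⟩) htri.1
    · exact noadd e ((hT e).2 ⟨Or.inr heB, htriW⟩) htri.1
  have closeB : ∀ e ∈ B, ∀ f ∈ Hb, ∀ x y, x ≠ y → x ∈ e → y ∈ e → x ∈ f → y ∈ f → f ∈ B := by
    intro e he f hf x y hxy hxe hye hxf hyf
    rw [hB] at he ⊢
    exact mem_seededComponent_of_common_pair h.card_blue he hf hxy hxe hye hxf hyf
  have hMR : M ⊆ R := by
    intro e he
    refine ((hT e).1 (hMT he)).1.resolve_right fun heB => ?_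
    have htri := ((hT e).1 (hMT he)).2
    have noswap : ∀ f ∈ Hr, IsTriangleIn N (VR ∪ VB) f → f ⊆ e ∪ U → ¬ ∃ v ∈ f, v ∈ VR := by
      intro f hf hftri hfU hv
      have := hmax {e} (Finset.singleton_subset_iff.2 he) {f}
        (Finset.singleton_subset_iff.2 (useR f hf hftri hv)) (isMatching_singleton _) (by
          intro g hg x hx
          rw [Finset.mem_singleton] at hg
          subst hg
          rw [Finset.singleton_biUnion]
          exact (Finset.mem_union.1 (hfU hx)).imp id (outside x))
      rw [Finset.sum_singleton, Finset.sum_singleton, weight_red f hf,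
        weight_blue e (hBb heB)] at this
      omega
    obtain ⟨x, hx, y, hy, hxy⟩ := Finset.one_lt_card.1 (by rw [htri.2.1]; norm_num : 1 < e.card)
    have hxW := htri.1 hx
    have hyW := htri.1 hy
    have hNxy := htri.2.2 x hx y hy hxy
    have inl : ∀ {z}, z ∈ e → z ∈ e ∪ U := fun hz => Finset.mem_union_left _ hz
    have inr : ∀ {z}, z ∈ U → z ∈ e ∪ U := fun hz => Finset.mem_union_right _ hz
    have hc : 3 * k + (∅ : Finset V).card < U.card := by rw [Finset.card_empty]; omega
    obtain ⟨u, hu, -, hxu, hyu, he1⟩ := h.exists_extension hUW hxW hyW hNxy hc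
    have b1 : ({x, y, u} : Finset V) ∈ Hb := (Finset.mem_union.1 he1).resolve_left fun hr =>
      noswap _ hr (h.isTriangleIn hxW hyW (hUW hu) hNxy hxu hyu)
        (triple_subset (inl hx) (inl hy) (inr hu)) ⟨u, by simp, hUR hu⟩
    have B1 := closeB e heB _ b1 x y hxy hx hy (by simp) (by simp)
    obtain ⟨w, hw, -, hxw, huw, he2⟩ := h.exists_extension hUW hxW (hUW hu) hxu hc
    have b2 : ({x, u, w} : Finset V) ∈ Hb := (Finset.mem_union.1 he2).resolve_left fun hr =>
      noswap _ hr (h.isTriangleIn hxW (hUW hu) (hUW hw) hxu hxw huw)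
        (triple_subset (inl hx) (inr hu) (inr hw)) ⟨u, by simp, hUR hu⟩
    have B2 := closeB _ B1 _ b2 x u (h.ne _ _ hxu) (by simp) (by simp) (by simp) (by simp)
    obtain ⟨z, hz, -, huz, hwz, he3⟩ := h.exists_extension hUW (hUW hu) (hUW hw) huw hc
    obtain ⟨b3, B3⟩ := triU _ he3 (h.isTriangleIn hu hw hz huw huz hwz)
    exact B3 (closeB _ B2 _ b3 u w (h.ne _ _ huw) (by simp) (by simp) (by simp) (by simp))
  obtain ⟨Mb, hMb, hMbU, hMbcard⟩ := h.exists_matching_of_forall_blue hUW (by omega)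
    fun e he htri => (triU e he htri).1
  have hdisj : Disjoint (M.biUnion id) (Mb.biUnion id) :=
    Finset.disjoint_left.2 fun x hx hx' => outside x (hMbU hx') hx
  refine ⟨M, Mb, connR M subset_rfl hMR, hMb, hdisj, ?_⟩
  rw [Finset.card_union_of_disjoint hdisj]
  omega

theorem exists_matchings (h : CleanColouring Hr Hb VR VB N k) :
    ∃ Mr Mb, IsConnectedMatchingIn Hr Mr ∧ IsConnectedMatchingIn Hb Mb ∧
      Disjoint (Mr.biUnion id) (Mb.biUnion id) ∧
      (VR ∪ VB).card ≤ (Mr.biUnion id ∪ Mb.biUnion id).card + (10 * k + 10) := by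
  rcases le_total VB.card VR.card with hle | hle
  · exact h.exists_matchings_of_card_le hle
  · obtain ⟨Mb, Mr, h1, h2, h3, h4⟩ := h.swap.exists_matchings_of_card_le hle
    refine ⟨Mr, Mb, h2, h1, h3.symm, ?_⟩
    rwa [Finset.union_comm VR, Finset.union_comm (Mr.biUnion id)]

end CleanColouring

/-- The number of vertices which do not extend the pair `v w` to an edge of `H`. -/
noncomputable def codefect {V : Type*} [Fintype V] [DecidableEq V] (H : Finset (Finset V))
    (v w : V) : ℕ :=
  (Finset.univ.filter fun z => ({v, w, z} : Finset V) ∉ H).card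

theorem six_mul_card_le_card_triples {V : Type*} [Fintype V] [DecidableEq V]
    {H : Finset (Finset V)} (hH : ∀ e ∈ H, e.card = 3) :
    6 * H.card ≤ (Finset.univ.filter fun p : V × V × V =>
      ({p.1, p.2.1, p.2.2} : Finset V) ∈ H).card := by
  have hfib := Finset.card_eq_sum_card_fiberwise
    (s := Finset.univ.filter fun p : V × V × V => ({p.1, p.2.1, p.2.2} : Finset V) ∈ H)
    (f := fun p : V × V × V => ({p.1, p.2.1, p.2.2} : Finset V))
    (t := H) (fun p hp => (Finset.mem_filter.1 hp).2)
  rw [hfib, mul_comm, ← smul_eq_mul]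
  refine Finset.card_nsmul_le_sum _ _ _ fun e he => ?_
  obtain ⟨x, y, z, hxy, hxz, hyz, rfl⟩ := Finset.card_eq_three.1 (hH e he)
  have h6 : ({(x, y, z), (x, z, y), (y, x, z), (y, z, x), (z, x, y), (z, y, x)} :
      Finset (V × V × V)).card = 6 := by
    have := hxy.symm
    have := hxz.symm
    have := hyz.symm
    simp [Finset.card_insert_of_notMem, *]
  rw [← h6]
  apply Finset.card_le_card
  intro p hp
  have key : ({p.1, p.2.1, p.2.2} : Finset V) = {x, y, z} := by
    simp only [Finset.mem_insert, Finset.mem_singleton] at hp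
    rcases hp with rfl | rfl | rfl | rfl | rfl | rfl <;> ext a <;>
      simp only [Finset.mem_insert, Finset.mem_singleton] <;> constructor <;>
      rintro (h | h | h) <;> simp [h]
  simp only [Finset.mem_filter, Finset.mem_univ, key, he, and_self]

theorem sum_codefect_add {V : Type*} [Fintype V] [DecidableEq V]
    {H : Finset (Finset V)} (hH : ∀ e ∈ H, e.card = 3) :
    (∑ v, ∑ w, codefect H v w) + 6 * H.card ≤ Fintype.card V ^ 3 := by
  have h1 : ∑ v, ∑ w, codefect H v w = (Finset.univ.filter fun p : V × V × V =>
      ({p.1, p.2.1, p.2.2} : Finset V) ∉ H).card := by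
    simp only [codefect, Finset.card_filter, Fintype.sum_prod_type]
  have h2 := six_mul_card_le_card_triples hH
  have h3 := Finset.card_filter_add_card_filter_not (s := (Finset.univ : Finset (V × V × V)))
    (fun p => ({p.1, p.2.1, p.2.2} : Finset V) ∈ H)
  have h4 : (Finset.univ : Finset (V × V × V)).card = Fintype.card V ^ 3 := by
    rw [Finset.card_univ, Fintype.card_prod, Fintype.card_prod]; ring
  omega

theorem card_filter_lt_mul_le_sum {ι : Type*} (s : Finset ι) (f : ι → ℕ) (c : ℝ) :
    ((s.filter fun x => c < f x).card : ℝ) * c ≤ ∑ x ∈ s, (f x : ℝ) := by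
  rw [← nsmul_eq_mul]
  refine (Finset.card_nsmul_le_sum _ (fun x => (f x : ℝ)) c
    fun x hx => (Finset.mem_filter.1 hx).2.le).trans ?_
  exact Finset.sum_le_sum_of_subset_of_nonneg (Finset.filter_subset _ _)
    fun x _ _ => Nat.cast_nonneg _

/-- The edges of `G` containing `v` and a vertex of `A` lie in one tight component, and every
vertex of `A` is in such an edge. -/
def IsPinned {V : Type*} [DecidableEq V] (G : Finset (Finset V)) (v : V) (A : Finset V) : Prop :=
  (∀ x ∈ A, ∃ e ∈ G, v ∈ e ∧ x ∈ e) ∧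
    ∀ x ∈ A, ∀ y ∈ A, ∀ e ∈ G, ∀ f ∈ G, v ∈ e → x ∈ e → v ∈ f → y ∈ f → TightConn G e f

theorem card_triple_lt_of_eq {V : Type*} [DecidableEq V] (v z : V) :
    ({v, v, z} : Finset V).card < 3 := by
  rw [Finset.insert_eq_of_mem (Finset.mem_insert_self v {z})]
  exact Nat.lt_succ_of_le Finset.card_le_two

theorem isPinned_of_connected_link {V : Type*} [DecidableEq V] {G : Finset (Finset V)}
    (hG : ∀ e ∈ G, e.card = 3) {v : V} {A : Finset V} (hv : v ∉ A)
    (h1 : ∀ y ∈ A, ∃ z, ({v, y, z} : Finset V) ∈ G)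
    (h2 : ∀ y ∈ A, ∀ z ∈ A,
      Relation.ReflTransGen (fun y z => ({v, y, z} : Finset V) ∈ G) y z) : IsPinned G v A := by
  refine ⟨fun x hx => ?_, fun x hx y hy e he f hf hve hxe hvf hyf => ?_⟩
  · obtain ⟨z, hz⟩ := h1 x hx
    exact ⟨_, hz, by simp, by simp⟩
  have hvy : v ≠ y := fun h => hv (h ▸ hy)
  have hvx : v ≠ x := fun h => hv (h ▸ hx)
  have hxy := h2 x hx y hy
  clear hx
  induction hxy using Relation.ReflTransGen.head_induction_on generalizing e with
  | refl => exact tightConn_of_common_pair hG he hf hvy hve hxe hvf hyf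
  | @head x c hxc _ ih =>
    have hvc : v ≠ c := by
      rintro rfl
      have h3 := hG _ hxc
      have h4 := card_triple_lt_of_eq v x
      rw [Finset.pair_comm] at h3
      omega
    exact (tightConn_of_common_pair hG he hxc hvx hve hxe (by simp) (by simp)).trans
      (ih _ hxc (by simp) (by simp) hvc)

theorem exists_isPinned {V : Type*} [Fintype V] [DecidableEq V] {Hr Hb : Finset (Finset V)}
    (hr : ∀ e ∈ Hr, e.card = 3) (hb : ∀ e ∈ Hb, e.card = 3) {c : ℝ}
    (hc : 4 * c < Fintype.card V) (hc0 : 0 ≤ c) {v : V}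
    (hv : ((Finset.univ.filter fun w => c < codefect (Hr ∪ Hb) v w).card : ℝ) ≤ c) :
    ∃ A : Finset V, (∀ w ∈ A, v ≠ w ∧ (codefect (Hr ∪ Hb) v w : ℝ) ≤ c) ∧
      (((Finset.univ.filter fun w => w ∉ A).card : ℝ) ≤ 3 * c) ∧
      (IsPinned Hr v A ∨ IsPinned Hb v A) := by
  obtain ⟨Y, hY⟩ : ∃ Y : Finset V, Y = Finset.univ.filter
    fun w => ¬ c < codefect (Hr ∪ Hb) v w := ⟨_, rfl⟩
  have hYc := Finset.card_filter_add_card_filter_not (s := (Finset.univ : Finset V))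
    (fun w => c < codefect (Hr ∪ Hb) v w)
  rw [← hY, Finset.card_univ] at hYc
  have hYR : (Fintype.card V : ℝ) - c ≤ Y.card := by
    rw [← hYc]; push_cast; linarith
  have hfl : (⌊c⌋₊ : ℝ) ≤ c := Nat.floor_le hc0
  have hYmem : ∀ y ∈ Y, (codefect (Hr ∪ Hb) v y : ℝ) ≤ c := by
    intro y hy
    rw [hY] at hy
    exact not_lt.1 (Finset.mem_filter.1 hy).2
  have hsymm : ∀ (G : Finset (Finset V)) (x y : V), ({v, x, y} : Finset V) ∈ G →
      ({v, y, x} : Finset V) ∈ G := fun G x y h => by rwa [Finset.pair_comm]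
  obtain ⟨A, hAY, hAc, hA⟩ := exists_large_monochromatic_connected_part
    (r := fun y z => ({v, y, z} : Finset V) ∈ Hr) (b := fun y z => ({v, y, z} : Finset V) ∈ Hb)
    (hsymm Hr) (hsymm Hb) (Y := Y) (k := ⌊c⌋₊) (by
      intro y hy
      refine Nat.le_floor (le_trans ?_ (hYmem y hy))
      refine Nat.cast_le.2 (Finset.card_le_card ?_)
      intro z hz
      simp only [Finset.mem_filter, Finset.mem_univ, true_and, Finset.mem_union] at hz ⊢
      exact hz.2) (by
      have : ((3 * ⌊c⌋₊ : ℕ) : ℝ) < Y.card := by push_cast; linarith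
      exact_mod_cast this)
  have hvA : ∀ w ∈ A, v ≠ w := by
    rintro w hw rfl
    have h1 := hYmem v (hAY hw)
    have h2 : codefect (Hr ∪ Hb) v v = Fintype.card V := by
      rw [codefect, Finset.filter_true_of_mem, Finset.card_univ]
      intro z _ hz
      have h3 := card_triple_lt_of_eq v z
      rcases Finset.mem_union.1 hz with hz | hz
      · have := hr _ hz; omega
      · have := hb _ hz; omega
    rw [h2] at h1
    linarith
  refine ⟨A, fun w hw => ⟨hvA w hw, hYmem w (hAY hw)⟩, ?_, ?_⟩
  · have h1 := Finset.card_filter_add_card_filter_not (s := (Finset.univ : Finset V))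
      (fun w => w ∈ A)
    rw [Finset.filter_univ_mem, Finset.card_univ] at h1
    have h2 : ((A.card : ℝ) + ((Finset.univ.filter fun w => w ∉ A).card : ℝ)) =
      Fintype.card V := by exact_mod_cast h1
    have h3 : (Y.card : ℝ) ≤ A.card + 2 * ⌊c⌋₊ := by exact_mod_cast hAc
    linarith
  · exact hA.imp (fun h => isPinned_of_connected_link hr (fun hh => hvA v hh rfl) h.1 h.2)
      (fun h => isPinned_of_connected_link hb (fun hh => hvA v hh rfl) h.1 h.2)

theorem tightConn_of_forall_isPinned {V : Type*} [DecidableEq V] {G : Finset (Finset V)}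
    {W S : Finset V} {A : V → Finset V} {k : ℕ} (hSW : S ⊆ W)
    (hS : ∀ v ∈ S, IsPinned G v (A v)) (hk : 2 * k < S.card)
    (hnon : ∀ v ∈ W, (W.filter fun w => ¬ (w ∈ A v ∧ v ∈ A w)).card ≤ k) :
    ∀ v ∈ S, ∀ v' ∈ S, ∀ w ∈ A v, ∀ w' ∈ A v', ∀ e ∈ G, ∀ e' ∈ G,
      v ∈ e → w ∈ e → v' ∈ e' → w' ∈ e' → TightConn G e e' := by
  intro v hv v' hv' w hw w' hw' e he e' he' hve hwe hve' hwe'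
  obtain ⟨u, hu, hun⟩ := exists_mem_avoiding (U := S)
    (S := (W.filter fun w => ¬ (w ∈ A v ∧ v ∈ A w)) ∪
      (W.filter fun w => ¬ (w ∈ A v' ∧ v' ∈ A w))) (by
    have h1 := hnon v (hSW hv)
    have h2 := hnon v' (hSW hv')
    have h3 := Finset.card_union_le (W.filter fun w => ¬ (w ∈ A v ∧ v ∈ A w))
      (W.filter fun w => ¬ (w ∈ A v' ∧ v' ∈ A w))
    omega)
  have huW := hSW hu
  rw [Finset.mem_union, Finset.mem_filter, Finset.mem_filter] at hun
  have n1 : u ∈ A v ∧ v ∈ A u := by tauto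
  have n2 : u ∈ A v' ∧ v' ∈ A u := by tauto
  obtain ⟨g, hg, hvg, hug⟩ := (hS v hv).1 u n1.1
  obtain ⟨g', hg', hvg', hug'⟩ := (hS v' hv').1 u n2.1
  have c1 := (hS v hv).2 w hw u n1.1 e he g hg hve hwe hvg hug
  have c2 := (hS u hu).2 v n1.2 v' n2.2 g hg g' hg' hug hvg hug' hvg'
  have c3 := (hS v' hv').2 u n2.1 w' hw' g' hg' e' he' hvg' hug' hve' hwe'
  exact (c1.trans c2).trans c3

theorem exists_cleanColouring {V : Type*} [Fintype V] [DecidableEq V] {Hr Hb : Finset (Finset V)}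
    (hr : ∀ e ∈ Hr, e.card = 3) (hb : ∀ e ∈ Hb, e.card = 3) (hdis : Disjoint Hr Hb) {δ : ℝ}
    (hδ : 0 < δ) (hδ1 : 290 * δ < 1) (ht : 0 < Fintype.card V)
    (hsum : ∑ v, ∑ w, (codefect (Hr ∪ Hb) v w : ℝ) ≤ 2 * δ ^ 6 * (Fintype.card V : ℝ) ^ 3) :
    ∃ VR VB N k, CleanColouring Hr Hb VR VB N k ∧ (k : ℝ) ≤ 2 * δ * Fintype.card V ∧
      (Fintype.card V : ℝ) ≤ (VR ∪ VB).card + 14 * δ * Fintype.card V := by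
  obtain ⟨t, htdef⟩ : ∃ t : ℝ, t = Fintype.card V := ⟨_, rfl⟩
  have ht0 : 0 < t := by rw [htdef]; exact_mod_cast ht
  rw [← htdef] at hsum ⊢
  have hδ2 : δ ^ 2 ≤ δ / 290 := by nlinarith
  obtain ⟨c, hc⟩ : ∃ c : ℝ, c = δ ^ 2 * t := ⟨_, rfl⟩
  have hc0 : 0 < c := by rw [hc]; positivity
  have hcδ : c ≤ δ / 290 * t := by rw [hc]; exact mul_le_mul_of_nonneg_right hδ2 ht0.le
  have hδt : 0 < δ * t := by positivity
  have hct : 4 * c < t := by nlinarith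
  -- vertices in many pairs of large codefect
  obtain ⟨P, hP⟩ : ∃ P : V → ℕ, ∀ v, P v =
    (Finset.univ.filter fun w => c < codefect (Hr ∪ Hb) v w).card := ⟨_, fun _ => rfl⟩
  obtain ⟨Z, hZ⟩ : ∃ Z : Finset V, Z = Finset.univ.filter fun v => c < P v := ⟨_, rfl⟩
  have hZmem : ∀ v, v ∉ Z ↔ (P v : ℝ) ≤ c := by intro v; rw [hZ]; simp
  have hZcard : (Z.card : ℝ) ≤ 2 * δ ^ 2 * t := by
    have h1 := card_filter_lt_mul_le_sum Finset.univ P c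
    rw [← hZ] at h1
    have h2 : (∑ v, (P v : ℝ)) * c ≤ ∑ v, ∑ w, (codefect (Hr ∪ Hb) v w : ℝ) := by
      rw [Finset.sum_mul]
      refine Finset.sum_le_sum fun v _ => ?_
      rw [hP]
      exact card_filter_lt_mul_le_sum _ _ _
    have h3 : (Z.card : ℝ) * c * c ≤ 2 * δ ^ 6 * t ^ 3 :=
      ((mul_le_mul_of_nonneg_right h1 hc0.le).trans h2).trans hsum
    have h4 : 2 * δ ^ 6 * t ^ 3 = 2 * δ ^ 2 * t * (c * c) := by rw [hc]; ring
    rw [h4, mul_assoc] at h3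
    exact le_of_mul_le_mul_right h3 (by positivity)
  have hpin : ∀ v, ∃ A : Finset V, (∀ w ∈ A, v ≠ w ∧ (codefect (Hr ∪ Hb) v w : ℝ) ≤ c) ∧
      (v ∉ Z → (((Finset.univ.filter fun w => w ∉ A).card : ℝ) ≤ 3 * c) ∧
        (IsPinned Hr v A ∨ IsPinned Hb v A)) := by
    intro v
    by_cases hv : v ∈ Z
    · exact ⟨∅, by simp, fun h => absurd hv h⟩
    · obtain ⟨A, h1, h2, h3⟩ := exists_isPinned hr hb (c := c) (by rw [← htdef]; exact hct) hc0.le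
        (v := v) (by rw [← hP]; exact (hZmem v).1 hv)
      exact ⟨A, h1, fun _ => ⟨h2, h3⟩⟩
  choose A hA1 hA2 using hpin
  -- vertices missing from many of the sets `A v`
  obtain ⟨Q, hQ⟩ : ∃ Q : V → ℕ, ∀ w, Q w =
    ((Finset.univ \ Z).filter fun v => w ∉ A v).card := ⟨_, fun _ => rfl⟩
  obtain ⟨X, hX⟩ : ∃ X : Finset V, X = Finset.univ.filter fun w => δ * t < Q w := ⟨_, rfl⟩
  have hXmem : ∀ v, v ∉ X ↔ (Q v : ℝ) ≤ δ * t := by intro v; rw [hX]; simp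
  have hXcard : (X.card : ℝ) ≤ 3 * δ * t := by
    have h1 := card_filter_lt_mul_le_sum Finset.univ Q (δ * t)
    rw [← hX] at h1
    have h2 : ∑ w, Q w = ∑ v ∈ Finset.univ \ Z, (Finset.univ.filter fun w => w ∉ A v).card := by
      simp only [hQ, Finset.card_filter]
      exact Finset.sum_comm
    have h3 : ∑ w, (Q w : ℝ) ≤ ∑ _v ∈ Finset.univ \ Z, 3 * c := by
      rw [← Nat.cast_sum, h2, Nat.cast_sum]
      exact Finset.sum_le_sum fun v hv => (hA2 v (Finset.mem_sdiff.1 hv).2).1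
    rw [Finset.sum_const, nsmul_eq_mul] at h3
    have h4 : ((Finset.univ \ Z).card : ℝ) ≤ t := by
      rw [htdef]; exact_mod_cast Finset.card_le_univ _
    have h5 : ((Finset.univ \ Z).card : ℝ) * (3 * c) ≤ t * (3 * c) :=
      mul_le_mul_of_nonneg_right h4 (by positivity)
    have h6 : t * (3 * c) = 3 * δ * t * (δ * t) := by rw [hc]; ring
    exact le_of_mul_le_mul_right (by linarith) hδt
  obtain ⟨W, hW⟩ : ∃ W : Finset V, W = Finset.univ \ (Z ∪ X) := ⟨_, rfl⟩
  have hWZ : ∀ v ∈ W, v ∉ Z := by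
    intro v hv hvZ
    rw [hW] at hv
    exact (Finset.mem_sdiff.1 hv).2 (Finset.mem_union_left _ hvZ)
  have hWX : ∀ v ∈ W, v ∉ X := by
    intro v hv hvX
    rw [hW] at hv
    exact (Finset.mem_sdiff.1 hv).2 (Finset.mem_union_right _ hvX)
  have hWcard : t ≤ W.card + Z.card + X.card := by
    have h1 := Finset.card_sdiff_add_card_eq_card (Finset.subset_univ (Z ∪ X))
    rw [← hW, Finset.card_univ] at h1
    have h2 := Finset.card_union_le Z X
    rw [htdef]
    exact_mod_cast (by omega : Fintype.card V ≤ W.card + Z.card + X.card)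
  obtain ⟨k, hk⟩ : ∃ k : ℕ, k = ⌊2 * δ * t⌋₊ := ⟨_, rfl⟩
  have hkle : (k : ℝ) ≤ 2 * δ * t := by rw [hk]; exact Nat.floor_le (by positivity)
  have hnon : ∀ v ∈ W, (W.filter fun w => ¬ (w ∈ A v ∧ v ∈ A w)).card ≤ k := by
    intro v hv
    rw [hk]
    refine Nat.le_floor ?_
    have h1 := (hA2 v (hWZ v hv)).1
    have h2 := (hXmem v).1 (hWX v hv)
    rw [hQ] at h2
    have h3 : W.filter (fun w => ¬ (w ∈ A v ∧ v ∈ A w)) ⊆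
        (Finset.univ.filter fun w => w ∉ A v) ∪
          ((Finset.univ \ Z).filter fun w => v ∉ A w) := by
      intro w hw
      rw [Finset.mem_filter] at hw
      have hwZ := hWZ w hw.1
      simp only [Finset.mem_union, Finset.mem_filter, Finset.mem_sdiff, Finset.mem_univ, true_and]
      tauto
    have h4 : ((W.filter (fun w => ¬ (w ∈ A v ∧ v ∈ A w))).card : ℝ) ≤
        (Finset.univ.filter fun w => w ∉ A v).card +
          ((Finset.univ \ Z).filter fun w => v ∉ A w).card := by
      exact_mod_cast (Finset.card_le_card h3).trans (Finset.card_union_le _ _)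
    linarith
  have trim : ∀ (G : Finset (Finset V)) (S : Finset V), S ⊆ W → (∀ v ∈ S, IsPinned G v (A v)) →
      ∃ S' ⊆ S, S.card ≤ S'.card + 2 * k ∧
      ∀ v ∈ S', ∀ v' ∈ S', ∀ w ∈ A v, ∀ w' ∈ A v', ∀ e ∈ G, ∀ e' ∈ G,
        v ∈ e → w ∈ e → v' ∈ e' → w' ∈ e' → TightConn G e e' := by
    intro G S hSW hS
    by_cases hcard : 2 * k < S.card
    · exact ⟨S, subset_rfl, by omega, tightConn_of_forall_isPinned hSW hS hcard hnon⟩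
    · exact ⟨∅, Finset.empty_subset _, by omega, by simp⟩
  obtain ⟨VR, hVRs, hVRc, hVR⟩ := trim Hr (W.filter fun v => IsPinned Hr v (A v))
    (Finset.filter_subset _ _) fun v hv => (Finset.mem_filter.1 hv).2
  obtain ⟨VB, hVBs, hVBc, hVB⟩ := trim Hb (W.filter fun v => ¬ IsPinned Hr v (A v))
    (Finset.filter_subset _ _) fun v hv =>
      (hA2 v (hWZ v (Finset.mem_filter.1 hv).1)).2.resolve_left (Finset.mem_filter.1 hv).2
  have hsub : VR ∪ VB ⊆ W := Finset.union_subset (hVRs.trans (Finset.filter_subset _ _))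
    (hVBs.trans (Finset.filter_subset _ _))
  have hdisj : Disjoint VR VB := Finset.disjoint_left.2 fun x hx hx' =>
    (Finset.mem_filter.1 (hVBs hx')).2 (Finset.mem_filter.1 (hVRs hx)).2
  refine ⟨VR, VB, fun v w => w ∈ A v ∧ v ∈ A w, k, ?_, hkle, ?_⟩
  · exact
      { card_red := hr
        card_blue := hb
        disjoint_colours := hdis
        symm := fun v w h => ⟨h.2, h.1⟩
        ne := fun v w h => (hA1 v w h.1).1
        card_nonadj := by
          intro v hv
          refine le_trans (Finset.card_le_card fun w hw => ?_) (hnon v (hsub hv))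
          simp only [Finset.mem_filter] at hw ⊢
          exact ⟨hsub hw.1, hw.2⟩
        card_missing := by
          intro v w h
          rw [hk]
          refine Nat.le_floor ((hA1 v w h.1).2.trans ?_)
          linarith
        conn_red := fun v hv v' hv' w w' h h' => hVR v hv v' hv' w h.1 w' h'.1
        conn_blue := fun v hv v' hv' w w' h h' => hVB v hv v' hv' w h.1 w' h'.1 }
  · have h1 := Finset.card_filter_add_card_filter_not (s := W) (fun v => IsPinned Hr v (A v))
    have h2 := Finset.card_union_of_disjoint hdisj
    have h3 : (W.card : ℝ) ≤ (VR ∪ VB).card + 4 * k := by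
      exact_mod_cast (by omega : W.card ≤ (VR ∪ VB).card + 4 * k)
    nlinarith

/-- Theorem: monochromatic connected matchings: For all `γ > 0` there is
`t₀` such that every 3-uniform hypergraph `H` on `t > t₀` vertices with at least
`(1-γ)·C(t,3)` edges and every 2-colouring `H = H_red ∪ H_blue` admit two vertex-disjoint
monochromatic connected matchings, of distinct colours, covering at least
`(1 - 290γ^{1/6})·t` vertices. -/
theorem two_disjoint_mono_connected_matchings (γ : ℝ) (hγ : 0 < γ) :
    ∃ t₀ : ℕ, ∀ (V : Type) (_ : Fintype V) (_ : DecidableEq V),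
      Fintype.card V > t₀ →
      ∀ H Hred Hblue : Finset (Finset V),
        (∀ e ∈ H, e.card = 3) →
        ((H.card : ℝ) ≥ (1 - γ) * ((Fintype.card V).choose 3)) →
        Hred ∪ Hblue = H → Disjoint Hred Hblue →
        ∃ Mred Mblue : Finset (Finset V),
          IsConnectedMatchingIn Hred Mred ∧
          IsConnectedMatchingIn Hblue Mblue ∧
          Disjoint (Mred.biUnion id) (Mblue.biUnion id) ∧
          (((Mred.biUnion id ∪ Mblue.biUnion id).card : ℝ) ≥
            (1 - 290 * γ ^ ((1 : ℝ) / 6)) * (Fintype.card V)) := by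
  obtain ⟨δ, hδ⟩ : ∃ δ : ℝ, δ = γ ^ ((1 : ℝ) / 6) := ⟨_, rfl⟩
  have hδ0 : 0 < δ := by rw [hδ]; positivity
  have hδ6 : δ ^ 6 = γ := by
    rw [hδ, ← Real.rpow_natCast, ← Real.rpow_mul hγ.le]
    norm_num
  rw [← hδ]
  refine ⟨⌈10 / γ⌉₊, fun V _ _ hcard H Hred Hblue hH hHcard hunion hdis => ?_⟩
  obtain ⟨t, ht⟩ : ∃ t : ℝ, t = Fintype.card V := ⟨_, rfl⟩
  rw [← ht]
  by_cases hδ1 : 290 * δ < 1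
  swap
  · refine ⟨∅, ∅, ⟨by simp, by intro e he; simp at he, by simp⟩,
      ⟨by simp, by intro e he; simp at he, by simp⟩, by simp, ?_⟩
    have : 0 ≤ t := by rw [ht]; positivity
    simp only [Finset.biUnion_empty, Finset.empty_union, Finset.card_empty, Nat.cast_zero, ge_iff_le]
    exact mul_nonpos_of_nonpos_of_nonneg (by linarith) this
  have htγ : 10 ≤ γ * t := by
    have h1 : 10 / γ ≤ t := (Nat.le_ceil _).trans (by rw [ht]; exact_mod_cast hcard.le)
    rw [div_le_iff₀ hγ] at h1
    linarith
  have hpos : 0 < Fintype.card V := lt_of_le_of_lt (Nat.zero_le _) hcard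
  have ht0 : 0 < t := by rw [ht]; exact_mod_cast hpos
  have hγδ : γ ≤ δ := by
    rw [← hδ6]
    exact pow_le_of_le_one hδ0.le (by linarith) (by norm_num)
  have hchoose : t ^ 3 - 3 * t ^ 2 ≤ 6 * ((Fintype.card V).choose 3 : ℝ) := by
    have h1 : 6 * (Fintype.card V).choose 3 = (Fintype.card V).descFactorial 3 := by
      rw [Nat.descFactorial_eq_factorial_mul_choose]; rfl
    have h2 : (6 * ((Fintype.card V).choose 3 : ℝ)) = t * (t - 1) * (t - 2) := by
      have h3 : (6 * ((Fintype.card V).choose 3 : ℝ)) = ((Fintype.card V).descFactorial 3 : ℕ) := by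
        exact_mod_cast h1
      obtain ⟨m, hm⟩ : ∃ m, Fintype.card V = m + 2 := Nat.exists_eq_add_of_le' (by
        have : (2 : ℝ) ≤ Fintype.card V := by rw [← ht]; nlinarith
        exact_mod_cast this)
      rw [h3, ht, hm]
      simp only [Nat.descFactorial_succ, Nat.descFactorial_zero, Nat.add_sub_cancel,
        Nat.reduceSubDiff, Nat.sub_zero]
      push_cast
      ring
    rw [h2]
    nlinarith
  have hsum : ∑ v, ∑ w, (codefect (Hred ∪ Hblue) v w : ℝ) ≤
      2 * δ ^ 6 * (Fintype.card V : ℝ) ^ 3 := by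
    rw [hunion, hδ6, ← ht]
    have h1 : (∑ v, ∑ w, (codefect H v w : ℝ)) + 6 * H.card ≤ t ^ 3 := by
      rw [ht]; exact_mod_cast sum_codefect_add hH
    have h2 : (1 - γ) * (t ^ 3 - 3 * t ^ 2) ≤ 6 * (H.card : ℝ) := by
      have := mul_le_mul_of_nonneg_left hchoose (by linarith : 0 ≤ 1 - γ)
      linarith
    have h3 : 10 * t ^ 2 ≤ γ * t * t ^ 2 := mul_le_mul_of_nonneg_right htγ (by positivity)
    have h4 : 0 ≤ γ * t ^ 2 := by positivity
    nlinarith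
  obtain ⟨VR, VB, N, k, hclean, hk, hcov⟩ := exists_cleanColouring
    (fun e he => hH e (hunion ▸ Finset.mem_union_left _ he))
    (fun e he => hH e (hunion ▸ Finset.mem_union_right _ he)) hdis hδ0 hδ1 hpos hsum
  obtain ⟨Mr, Mb, h1, h2, h3, h4⟩ := hclean.exists_matchings
  refine ⟨Mr, Mb, h1, h2, h3, ?_⟩
  rw [← ht] at hk hcov
  have h5 : ((VR ∪ VB).card : ℝ) ≤ (Mr.biUnion id ∪ Mb.biUnion id).card + (10 * k + 10) := by
    exact_mod_cast h4
  have h6 : γ * t ≤ δ * t := mul_le_mul_of_nonneg_right hγδ ht0.le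
  nlinarith
end
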